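/- arXiv:2002.07475 — 2 statements merged into one kernel-verified Lean document; each statement's English description precedes it below -/
import Mathlib

section
/- Let f be a real additive function such that the series Σ_p min(1, f(p)²)/p and Σ_{p : |f(p)|≤1} f(p)/p converge and Σ_{p : f(p)≠0} 1/p < ∞. Then, uniformly for t ≥ 1 and positive integers m with 1 ≤ m ≤ t, one has u_f(m)·V_m(t) = ∏_p (1 − w_p) · t·h_f(m) + O(t·u_f(m)·R₀(t)), where R₀(t) := α_f(t) + β_f(t)^{1/4} + 1/(log 2t)^{1/6} and the implied constant may depend on f. -/
open Filter Topology Finset MeasureTheory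
open scoped Classical

noncomputable section

/-- A real additive arithmetic function. -/
def IsAdditive (f : ℕ → ℝ) : Prop :=
  ∀ m n : ℕ, 0 < m → 0 < n → Nat.Coprime m n → f (m * n) = f m + f n

/-- A real strongly additive arithmetic function. -/
def IsStronglyAdditive (f : ℕ → ℝ) : Prop :=
  IsAdditive f ∧ ∀ p ν : ℕ, p.Prime → 1 ≤ ν → f (p ^ ν) = f p

/-- Convergence of the two Erdős–Wintner series. -/
def EWConv (f : ℕ → ℝ) : Prop :=
  Summable (fun p : Nat.Primes => min 1 (f p ^ 2) / (p : ℝ)) ∧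
  ∃ ℓ : ℝ, Tendsto (fun N : ℕ =>
      ∑ p ∈ (Finset.range N).filter (fun p => Nat.Prime p ∧ |f p| ≤ 1), f p / (p : ℝ))
    atTop (𝓝 ℓ)

/-- The series over primes with f(p) ≠ 0 of 1/p. -/
def DivergentCase (f : ℕ → ℝ) : Prop :=
  ¬ Summable (fun p : Nat.Primes => if f (p : ℕ) ≠ 0 then (1 : ℝ) / (p : ℕ) else 0)

def EtaBound (f : ℕ → ℝ) (η : ℝ → ℝ) : Prop :=
  Continuous η ∧ Antitone η ∧ Tendsto η atTop (𝓝 0) ∧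
  (∀ y : ℝ, 1 ≤ y → ∃ ℓ : ℝ,
    Tendsto (fun N : ℕ =>
        ∑ p ∈ (Finset.range N).filter (fun p => Nat.Prime p ∧ y < (p : ℝ) ∧ |f p| ≤ 1),
          f p / (p : ℝ)) atTop (𝓝 ℓ) ∧ |ℓ| ≤ η y) ∧
  (∀ y : ℝ, 1 ≤ y →
    (∑' n : ℕ, if IsPrimePow n ∧ y < (n : ℝ) then min 1 (f n ^ 2) / (n : ℝ) else 0) ≤ η y)

/-- The truncated additive function f_R. -/
def fR (f : ℕ → ℝ) (R : ℝ) (n : ℕ) : ℝ :=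
  ∑ p ∈ n.primeFactors,
    (if ((p ^ (n.factorization p) : ℕ) : ℝ) ≤ R ∨ |f (p ^ (n.factorization p))| ≤ 1
      then f (p ^ (n.factorization p)) else 0)

/-- B_f(v) := sqrt(2 + Σ_{p^ν ≤ v} f(p^ν)²/p^ν). -/
def Bf (f : ℕ → ℝ) (v : ℝ) : ℝ :=
  Real.sqrt (2 + ∑ n ∈ (Finset.Icc 2 ⌊v⌋₊).filter IsPrimePow, f n ^ 2 / (n : ℝ))

/-- π_k(x) = #{n ≤ x : ω(n) = k}. -/
def pik (x : ℝ) (k : ℕ) : ℕ :=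
  ((Finset.Icc 1 ⌊x⌋₊).filter (fun n => n.primeFactors.card = k)).card

/-- The empirical distribution function. -/
def Fx (f : ℕ → ℝ) (x : ℝ) (y : ℝ) : ℝ :=
  (((Finset.Icc 1 ⌊x⌋₊).filter (fun n => f n ≤ y)).card : ℝ) / x

def uf (f : ℕ → ℝ) (m : ℕ) : ℝ :=
  if ∀ p ∈ m.primeFactors, f (p ^ (m.factorization p)) ≠ 0 then 1 else 0

def vf (f : ℕ → ℝ) (d : ℕ) : ℝ :=
  if ∀ p ∈ d.primeFactors, f (p ^ (d.factorization p)) = 0 then 1 else 0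

def wp (f : ℕ → ℝ) (p : ℕ) : ℝ :=
  (1 - 1 / (p : ℝ)) * ∑' ν : ℕ, uf f (p ^ (ν + 1)) / (p : ℝ) ^ (ν + 1)

def hf (f : ℕ → ℝ) (m : ℕ) : ℝ :=
  uf f m * ∏ p ∈ m.primeFactors, (1 - 1 / (p : ℝ)) / (1 - wp f p)

def alphaf (f : ℕ → ℝ) (y : ℝ) : ℝ :=
  ∑' p : Nat.Primes, if y < ((p : ℕ) : ℝ) then uf f (p : ℕ) / ((p : ℕ) : ℝ) else 0

def betaf (f : ℕ → ℝ) (y : ℝ) : ℝ :=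
  (1 / Real.log y) * ∫ t in (1:ℝ)..y, alphaf f t / t

def Flim (f : ℕ → ℝ) (y : ℝ) : ℝ :=
  (∏' p : Nat.Primes, (1 - wp f (p : ℕ))) *
    ∑' m : ℕ, if 1 ≤ m ∧ f m ≤ y then hf f m / m else 0

/-- V_m(t) := Σ_{d ≤ t, (d,m)=1} v_f(d). -/
def Vm (f : ℕ → ℝ) (m : ℕ) (t : ℝ) : ℝ :=
  ∑ d ∈ (Finset.Icc 1 ⌊t⌋₊).filter (fun d => Nat.Coprime d m), vf f d

/-! ### Arithmetic part -/

/-- `v_f` as an arithmetic function. -/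
def vA (f : ℕ → ℝ) : ArithmeticFunction ℝ := ⟨fun n => if n = 0 then 0 else vf f n, by simp⟩

lemma vA_apply (f : ℕ → ℝ) {n : ℕ} (hn : n ≠ 0) : vA f n = vf f n := by
  simp [vA, hn]

lemma vf_mul (f : ℕ → ℝ) {m n : ℕ} (hm : m ≠ 0) (hn : n ≠ 0) (h : Nat.Coprime m n) :
    vf f (m * n) = vf f m * vf f n := by
  have hd := h.disjoint_primeFactors
  have key : (∀ p ∈ (m * n).primeFactors, f (p ^ ((m * n).factorization p)) = 0) ↔
      (∀ p ∈ m.primeFactors, f (p ^ (m.factorization p)) = 0) ∧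
      (∀ p ∈ n.primeFactors, f (p ^ (n.factorization p)) = 0) := by
    rw [Nat.primeFactors_mul hm hn, Nat.factorization_mul hm hn]
    have h1 : ∀ p ∈ m.primeFactors, n.factorization p = 0 := fun p hp => by
      rw [← Finsupp.notMem_support_iff]
      exact Finset.disjoint_left.mp hd hp
    have h2 : ∀ p ∈ n.primeFactors, m.factorization p = 0 := fun p hp => by
      rw [← Finsupp.notMem_support_iff]
      exact Finset.disjoint_right.mp hd hp
    constructor
    · intro H
      refine ⟨fun p hp => ?_, fun p hp => ?_⟩
      · have := H p (Finset.mem_union_left _ hp)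
        simpa [h1 p hp] using this
      · have := H p (Finset.mem_union_right _ hp)
        simpa [h2 p hp] using this
    · rintro ⟨H1, H2⟩ p hp
      rcases Finset.mem_union.mp hp with hp | hp
      · simpa [h1 p hp] using H1 p hp
      · simpa [h2 p hp] using H2 p hp
  unfold vf
  simp only [key]
  split_ifs <;> first | (exfalso; tauto) | norm_num

lemma vA_mult (f : ℕ → ℝ) : (vA f).IsMultiplicative := by
  rw [ArithmeticFunction.IsMultiplicative.iff_ne_zero]
  refine ⟨by rw [vA_apply f one_ne_zero]; simp [vf], fun {m n} hm hn h => ?_⟩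
  rw [vA_apply f hm, vA_apply f hn, vA_apply f (mul_ne_zero hm hn), vf_mul f hm hn h]

/-- `g = μ * v_f`. -/
def gA (f : ℕ → ℝ) : ArithmeticFunction ℝ :=
  (ArithmeticFunction.moebius : ArithmeticFunction ℝ) * vA f

lemma gA_mult (f : ℕ → ℝ) : (gA f).IsMultiplicative :=
  (ArithmeticFunction.isMultiplicative_moebius.intCast).mul (vA_mult f)

lemma sum_gA (f : ℕ → ℝ) {n : ℕ} (hn : n ≠ 0) : ∑ d ∈ n.divisors, gA f d = vf f n := by
  rw [← vA_apply f hn, ← ArithmeticFunction.coe_zeta_mul_apply, gA, ← mul_assoc,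
    ArithmeticFunction.coe_zeta_mul_coe_moebius, one_mul]

lemma gA_pow (f : ℕ → ℝ) {p : ℕ} (hp : p.Prime) (k : ℕ) :
    gA f (p ^ (k + 1)) = vf f (p ^ (k + 1)) - vf f (p ^ k) := by
  have h1 := sum_gA f (pow_ne_zero (k + 1) hp.ne_zero)
  have h2 := sum_gA f (pow_ne_zero k hp.ne_zero)
  rw [Nat.sum_divisors_prime_pow hp] at h1 h2
  rw [Finset.sum_range_succ] at h1
  linarith

lemma vf_pow (f : ℕ → ℝ) {p : ℕ} (hp : p.Prime) (k : ℕ) :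
    vf f (p ^ (k + 1)) = 1 - uf f (p ^ (k + 1)) := by
  unfold vf uf
  rw [Nat.primeFactors_prime_pow (Nat.succ_ne_zero k) hp]
  by_cases h : f (p ^ (k + 1)) = 0 <;> simp [hp.factorization_self, h]

lemma vf_one (f : ℕ → ℝ) : vf f 1 = 1 := by simp [vf]

lemma uf_mem (f : ℕ → ℝ) (n : ℕ) : 0 ≤ uf f n ∧ uf f n ≤ 1 := by
  unfold uf; split_ifs <;> norm_num

lemma vf_mem (f : ℕ → ℝ) (n : ℕ) : 0 ≤ vf f n ∧ vf f n ≤ 1 := by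
  unfold vf; split_ifs <;> norm_num

lemma uf_prime (f : ℕ → ℝ) {p : ℕ} (hp : p.Prime) : uf f p = if f p ≠ 0 then 1 else 0 := by
  unfold uf
  rw [hp.primeFactors]
  simp [hp.factorization_self]

lemma gA_prime (f : ℕ → ℝ) {p : ℕ} (hp : p.Prime) : |gA f p| = uf f p := by
  have := gA_pow f hp 0
  rw [vf_pow f hp] at this
  simp only [zero_add, pow_one, pow_zero, vf_one] at this
  rw [this]
  have := (uf_mem f p).1
  rw [show 1 - uf f p - 1 = -uf f p by ring, abs_neg, abs_of_nonneg this]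

lemma gA_abs_pow (f : ℕ → ℝ) {p : ℕ} (hp : p.Prime) (k : ℕ) : |gA f (p ^ k)| ≤ 1 := by
  cases k with
  | zero => simp [(gA_mult f).map_one]
  | succ k =>
    rw [gA_pow f hp, abs_le]
    have h1 := vf_mem f (p ^ (k + 1))
    have h2 := vf_mem f (p ^ k)
    constructor <;> linarith

lemma gA_abs (f : ℕ → ℝ) (n : ℕ) : |gA f n| ≤ 1 := by
  induction n using Nat.recOnPosPrimePosCoprime with
  | prime_pow p n hp hn => exact gA_abs_pow f hp n
  | zero => simp
  | one => simp [(gA_mult f).map_one]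
  | coprime a b ha hb hab iha ihb =>
    rw [(gA_mult f).map_mul_of_coprime hab, abs_mul]
    exact mul_le_one₀ iha (abs_nonneg _) ihb

/-- `a(n) = |g(n)|/n`. -/
def aA (f : ℕ → ℝ) (n : ℕ) : ℝ := |gA f n| / n

lemma aA_nonneg (f : ℕ → ℝ) (n : ℕ) : 0 ≤ aA f n := by unfold aA; positivity

lemma aA_zero (f : ℕ → ℝ) : aA f 0 = 0 := by simp [aA]

lemma aA_one (f : ℕ → ℝ) : aA f 1 = 1 := by simp [aA, (gA_mult f).map_one]

lemma aA_mul (f : ℕ → ℝ) {m n : ℕ} (h : Nat.Coprime m n) :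
    aA f (m * n) = aA f m * aA f n := by
  unfold aA
  rw [(gA_mult f).map_mul_of_coprime h, abs_mul]
  push_cast
  rw [mul_div_mul_comm]

/-! ### Coprime counting -/

def Phi (m : ℕ) (x : ℝ) : ℝ := (((Finset.Icc 1 ⌊x⌋₊).filter (fun d => Nat.Coprime d m)).card : ℝ)

def Dm (m : ℕ) : ℝ := ∏ p ∈ m.primeFactors, (1 - 1 / (p : ℝ))

lemma Dm_eq_tot {m : ℕ} (hm : m ≠ 0) : Dm m = (m.totient : ℝ) / m := by
  have h := Nat.totient_eq_mul_prod_factors m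
  have h2 : (m.totient : ℝ) = m * ∏ p ∈ m.primeFactors, (1 - (p : ℝ)⁻¹) := by
    have h3 := congrArg (fun q : ℚ => (q : ℝ)) h
    push_cast at h3
    exact h3
  rw [h2, mul_div_cancel_left₀ _ (by exact_mod_cast hm)]
  simp [Dm]

lemma Dm_eq {m : ℕ} (hm : m ≠ 0) :
    Dm m = ∑ d ∈ m.divisors, (ArithmeticFunction.moebius d : ℝ) / d := by
  rw [Dm_eq_tot hm]
  have h := (ArithmeticFunction.sum_eq_iff_sum_mul_moebius_eq (R := ℝ)
    (f := fun n => (n.totient : ℝ)) (g := fun n => (n : ℝ))).mp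
    (fun n _ => by exact_mod_cast Nat.sum_totient n) m (Nat.pos_of_ne_zero hm)
  rw [← h, Nat.sum_divisorsAntidiagonal (fun i j => (ArithmeticFunction.moebius i : ℝ) * (j:ℝ)), Finset.sum_div]
  refine Finset.sum_congr rfl fun d hd => ?_
  have hd' := Nat.dvd_of_mem_divisors hd
  have hd0 : (d : ℝ) ≠ 0 := by
    exact_mod_cast (Nat.pos_of_mem_divisors hd).ne'
  have hm0 : (m : ℝ) ≠ 0 := by exact_mod_cast hm
  rw [Nat.cast_div hd' hd0]
  field_simp

lemma Dm_mem (m : ℕ) : 0 ≤ Dm m ∧ Dm m ≤ 1 := by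
  have h : ∀ p ∈ m.primeFactors, 0 ≤ 1 - 1 / (p : ℝ) ∧ 1 - 1 / (p : ℝ) ≤ 1 := fun p hp => by
    have hp1 : (1 : ℝ) ≤ p := by exact_mod_cast (Nat.prime_of_mem_primeFactors hp).one_lt.le
    have : 1 / (p : ℝ) ≤ 1 := by rw [div_le_one (by linarith)]; exact hp1
    have : 0 ≤ 1 / (p : ℝ) := by positivity
    constructor <;> linarith
  exact ⟨Finset.prod_nonneg fun p hp => (h p hp).1,
    Finset.prod_le_one (fun p hp => (h p hp).1) (fun p hp => (h p hp).2)⟩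

lemma coprime_ind (n m : ℕ) (hm : m ≠ 0) :
    (∑ d ∈ m.divisors, if d ∣ n then (ArithmeticFunction.moebius d : ℝ) else 0) =
      if Nat.Coprime n m then 1 else 0 := by
  rw [← Finset.sum_filter]
  have h1 : m.divisors.filter (fun d => d ∣ n) = (Nat.gcd n m).divisors := by
    ext d
    simp only [Finset.mem_filter, Nat.mem_divisors, Nat.dvd_gcd_iff, ne_eq]
    have : n.gcd m ≠ 0 := Nat.gcd_ne_zero_right hm
    tauto
  rw [h1]
  have h := congrArg (fun F : ArithmeticFunction ℝ => F (Nat.gcd n m))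
    (ArithmeticFunction.coe_zeta_mul_coe_moebius (R := ℝ))
  simp only [ArithmeticFunction.coe_zeta_mul_apply, ArithmeticFunction.one_apply] at h
  exact h

lemma Phi_le (m : ℕ) {x : ℝ} (hx : 0 ≤ x) : Phi m x ≤ x := by
  unfold Phi
  have : ((Finset.Icc 1 ⌊x⌋₊).filter (fun d => Nat.Coprime d m)).card ≤ ⌊x⌋₊ := by
    refine (Finset.card_filter_le _ _).trans (by simp)
  calc _ ≤ ((⌊x⌋₊ : ℕ) : ℝ) := by exact_mod_cast this
    _ ≤ x := Nat.floor_le hx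

lemma Phi_nonneg (m : ℕ) (x : ℝ) : 0 ≤ Phi m x := by unfold Phi; positivity

lemma Phi_est {m : ℕ} (hm : m ≠ 0) {x : ℝ} (hx : 0 ≤ x) :
    |Phi m x - x * Dm m| ≤ m.divisors.card := by
  have h1 : Phi m x = ∑ d ∈ m.divisors, (ArithmeticFunction.moebius d : ℝ) * (⌊x / d⌋₊ : ℝ) := by
    unfold Phi
    rw [Finset.card_filter]
    push_cast
    rw [Finset.sum_congr rfl (fun n _ => (coprime_ind n m hm).symm), Finset.sum_comm]
    refine Finset.sum_congr rfl fun d hd => ?_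
    rw [← Finset.sum_filter, Finset.sum_const, nsmul_eq_mul, mul_comm]
    congr 2
    rw [Nat.floor_div_natCast]
    exact_mod_cast Nat.Ioc_filter_dvd_card_eq_div ⌊x⌋₊ d
  rw [h1, Dm_eq hm, Finset.mul_sum, ← Finset.sum_sub_distrib]
  calc _ ≤ ∑ d ∈ m.divisors, |(ArithmeticFunction.moebius d : ℝ) * (⌊x / d⌋₊ : ℝ) -
          x * ((ArithmeticFunction.moebius d : ℝ) / d)| := Finset.abs_sum_le_sum_abs _ _
    _ ≤ ∑ d ∈ m.divisors, (1 : ℝ) := by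
      refine Finset.sum_le_sum fun d hd => ?_
      have e : (ArithmeticFunction.moebius d : ℝ) * (⌊x / d⌋₊ : ℝ) -
          x * ((ArithmeticFunction.moebius d : ℝ) / d) =
          (ArithmeticFunction.moebius d : ℝ) * ((⌊x / d⌋₊ : ℝ) - x / d) := by ring
      rw [e, abs_mul]
      have hmu : |(ArithmeticFunction.moebius d : ℝ)| ≤ 1 := by
        exact_mod_cast ArithmeticFunction.abs_moebius_le_one (n := d)
      have hfl : |(⌊x / d⌋₊ : ℝ) - x / d| ≤ 1 := by
        have a1 := Nat.floor_le (show 0 ≤ x / d by positivity)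
        have a2 := Nat.lt_floor_add_one (x / d)
        rw [abs_le]; constructor <;> linarith
      exact mul_le_one₀ hmu (abs_nonneg _) hfl
    _ = m.divisors.card := by simp

lemma card_div_le (m : ℕ) : (m.divisors.card : ℝ) ≤ 2 * Real.sqrt m := by
  have hsub : m.divisors ⊆ (Finset.Icc 1 (Nat.sqrt m)) ∪ (Finset.Icc 1 (Nat.sqrt m)).image (fun d => m / d) := by
    intro d hd
    have hd0 := Nat.pos_of_mem_divisors hd
    have hdvd := Nat.dvd_of_mem_divisors hd
    have hm0 : m ≠ 0 := (Nat.mem_divisors.mp hd).2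
    obtain ⟨e, rfl⟩ := hdvd
    have he0 : 0 < e := Nat.pos_of_ne_zero (by rintro rfl; simp at hm0)
    rw [Finset.mem_union, Finset.mem_image]
    rcases le_total d e with h | h
    · left
      rw [Finset.mem_Icc]
      exact ⟨hd0, Nat.le_sqrt.mpr (Nat.mul_le_mul_left d h)⟩
    · right
      refine ⟨e, Finset.mem_Icc.mpr ⟨he0, Nat.le_sqrt.mpr (Nat.mul_le_mul_right e h)⟩, ?_⟩
      exact Nat.mul_div_cancel _ he0
  have h1 : m.divisors.card ≤ Nat.sqrt m + Nat.sqrt m := by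
    refine (Finset.card_le_card hsub).trans ((Finset.card_union_le _ _).trans ?_)
    have := Finset.card_image_le (s := Finset.Icc 1 (Nat.sqrt m)) (f := fun d => m / d)
    simp only [Nat.card_Icc, Nat.add_sub_cancel] at this ⊢
    omega
  have h2 : ((Nat.sqrt m : ℕ) : ℝ) ≤ Real.sqrt m := Real.nat_sqrt_le_real_sqrt
  have h3 : (m.divisors.card : ℝ) ≤ (Nat.sqrt m : ℝ) + Nat.sqrt m := by exact_mod_cast h1
  linarith

lemma Vm_eq (f : ℕ → ℝ) (m : ℕ) (t : ℝ) :
    Vm f m t = ∑ b ∈ (Finset.Icc 1 ⌊t⌋₊).filter (fun d => Nat.Coprime d m), gA f b * Phi m (t / b) := by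
  unfold Vm
  have h1 : ∀ d ∈ (Finset.Icc 1 ⌊t⌋₊).filter (fun d => Nat.Coprime d m),
      vf f d = ∑ b ∈ (Finset.Icc 1 ⌊t⌋₊).filter (fun d => Nat.Coprime d m),
        if b ∣ d then gA f b else 0 := by
    intro d hd
    rw [Finset.mem_filter, Finset.mem_Icc] at hd
    rw [← sum_gA f (show d ≠ 0 by omega), ← Finset.sum_filter]
    refine Finset.sum_congr ?_ fun _ _ => rfl
    ext b
    simp only [Finset.mem_filter, Finset.mem_Icc, Nat.mem_divisors]
    constructor
    · rintro ⟨hb, h0⟩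
      have := Nat.le_of_dvd (by omega) hb
      have := Nat.pos_of_dvd_of_pos hb (by omega)
      exact ⟨⟨⟨by omega, by omega⟩, Nat.Coprime.coprime_dvd_left hb hd.2⟩, hb⟩
    · rintro ⟨_, hb⟩
      exact ⟨hb, by omega⟩
  rw [Finset.sum_congr rfl h1, Finset.sum_comm]
  refine Finset.sum_congr rfl fun b hb => ?_
  rw [Finset.mem_filter, Finset.mem_Icc] at hb
  rw [← Finset.sum_filter, Finset.sum_const, nsmul_eq_mul, mul_comm]
  congr 1
  unfold Phi
  rw [Nat.floor_div_natCast]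
  norm_cast
  symm
  apply Finset.card_bij (fun k _ => b * k)
  · intro k hk
    simp only [Finset.mem_filter, Finset.mem_Icc] at hk ⊢
    have := (Nat.le_div_iff_mul_le (by omega : 0 < b)).mp hk.1.2
    refine ⟨⟨⟨Nat.mul_pos (by omega) (by omega), by rw [mul_comm]; exact this⟩, ?_⟩, dvd_mul_right _ _⟩
    exact Nat.Coprime.mul_left hb.2 hk.2
  · intro k _ l _ h
    exact Nat.eq_of_mul_eq_mul_left (by omega) h
  · intro d hd
    simp only [Finset.mem_filter, Finset.mem_Icc] at hd
    obtain ⟨⟨⟨h1, h2⟩, h3⟩, k, rfl⟩ := hd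
    refine ⟨k, ?_, rfl⟩
    simp only [Finset.mem_filter, Finset.mem_Icc]
    refine ⟨⟨Nat.pos_of_ne_zero (by rintro rfl; simp at h1), ?_⟩, Nat.Coprime.coprime_mul_left h3⟩
    rw [Nat.le_div_iff_mul_le (by omega), mul_comm]
    exact h2

/-! ### Sums -/

lemma subadd_factor (c : ℕ → ℝ) (h1 : c 1 = 0)
    (hsub : ∀ m n : ℕ, 0 < m → 0 < n → c (m * n) ≤ c m + c n) (b : ℕ) (hb : b ≠ 0) :
    c b ≤ ∑ p ∈ b.primeFactors, c (p ^ b.factorization p) := by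
  induction b using Nat.recOnPosPrimePosCoprime with
  | prime_pow p n hp hn =>
    rw [Nat.primeFactors_prime_pow hn.ne' hp]
    simp [hp.factorization_self]
  | zero => simp at hb
  | one => simp [h1]
  | coprime a b ha hb' hab iha ihb =>
    have ha0 : a ≠ 0 := by omega
    have hb0 : b ≠ 0 := by omega
    have hd := hab.disjoint_primeFactors
    rw [Nat.primeFactors_mul ha0 hb0, Finset.sum_union hd, Nat.factorization_mul ha0 hb0]
    have e1 : ∑ p ∈ a.primeFactors, c (p ^ (a.factorization + b.factorization) p) =
        ∑ p ∈ a.primeFactors, c (p ^ a.factorization p) := by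
      refine Finset.sum_congr rfl fun p hp => ?_
      have : b.factorization p = 0 := by
        rw [← Finsupp.notMem_support_iff]
        exact Finset.disjoint_left.mp hd hp
      simp [this]
    have e2 : ∑ p ∈ b.primeFactors, c (p ^ (a.factorization + b.factorization) p) =
        ∑ p ∈ b.primeFactors, c (p ^ b.factorization p) := by
      refine Finset.sum_congr rfl fun p hp => ?_
      have : a.factorization p = 0 := by
        rw [← Finsupp.notMem_support_iff]
        exact Finset.disjoint_right.mp hd hp
      simp [this]
    rw [e1, e2]
    exact (hsub a b (by omega) (by omega)).trans (add_le_add (iha ha0) (ihb hb0))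

lemma key_sum (f : ℕ → ℝ) (c : ℕ → ℝ) (hc : ∀ n, 0 ≤ c n) (h1 : c 1 = 0)
    (hsub : ∀ m n : ℕ, 0 < m → 0 < n → c (m * n) ≤ c m + c n) (N : ℕ) :
    ∑ b ∈ Finset.Icc 1 N, aA f b * c b ≤
      (∑ q ∈ (Finset.Icc 1 N).filter IsPrimePow, aA f q * c q) * ∑ b ∈ Finset.Icc 1 N, aA f b := by
  have step : ∀ b ∈ Finset.Icc 1 N, aA f b * c b ≤ ∑ p ∈ b.primeFactors,
      (aA f (p ^ b.factorization p) * c (p ^ b.factorization p)) *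
        aA f (b / p ^ b.factorization p) := by
    intro b hb
    rw [Finset.mem_Icc] at hb
    calc aA f b * c b ≤ aA f b * ∑ p ∈ b.primeFactors, c (p ^ b.factorization p) :=
          mul_le_mul_of_nonneg_left (subadd_factor c h1 hsub b (by omega)) (aA_nonneg f b)
      _ = _ := by
          rw [Finset.mul_sum]
          refine Finset.sum_congr rfl fun p hp => ?_
          have hcop : Nat.Coprime (p ^ b.factorization p) (b / p ^ b.factorization p) :=
            (Nat.coprime_ordCompl (Nat.prime_of_mem_primeFactors hp) (by omega)).pow_left _
          have : aA f b = aA f (p ^ b.factorization p) * aA f (b / p ^ b.factorization p) := by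
            rw [← aA_mul f hcop, Nat.ordProj_mul_ordCompl_eq_self]
          rw [this]; ring
  refine (Finset.sum_le_sum step).trans ?_
  rw [Finset.sum_sigma', Finset.sum_mul_sum, ← Finset.sum_product']
  set F : ℕ × ℕ → ℝ := fun x => aA f x.1 * c x.1 * aA f x.2 with hF
  set φ : (Σ _ : ℕ, ℕ) → ℕ × ℕ := fun x =>
    (x.2 ^ x.1.factorization x.2, x.1 / x.2 ^ x.1.factorization x.2) with hφ
  have hmem : ∀ x ∈ (Finset.Icc 1 N).sigma (fun b => b.primeFactors),
      (1 ≤ x.1 ∧ x.1 ≤ N) ∧ x.2.Prime ∧ x.1.factorization x.2 ≠ 0 := by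
    intro x hx
    rw [Finset.mem_sigma, Finset.mem_Icc] at hx
    exact ⟨hx.1, Nat.prime_of_mem_primeFactors hx.2, Finsupp.mem_support_iff.mp hx.2⟩
  have hinj : Set.InjOn φ ((Finset.Icc 1 N).sigma (fun b => b.primeFactors)) := by
    rintro ⟨b, p⟩ hx ⟨b', p'⟩ hx' h
    obtain ⟨hb, hp, hk⟩ := hmem _ hx
    obtain ⟨hb', hp', hk'⟩ := hmem _ hx'
    simp only [hφ, Prod.mk.injEq] at h hb hp hk hb' hp' hk'
    have e1 : b = b' := by
      rw [← Nat.ordProj_mul_ordCompl_eq_self b p, ← Nat.ordProj_mul_ordCompl_eq_self b' p', h.2, h.1]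
    have e2 : p = p' := by
      have : p ∣ p' ^ b'.factorization p' := by
        rw [← h.1]; exact dvd_pow_self p hk
      exact (Nat.prime_dvd_prime_iff_eq hp hp').mp (hp.dvd_of_dvd_pow this)
    subst e1 e2; rfl
  have e : ∑ x ∈ (Finset.Icc 1 N).sigma (fun b => b.primeFactors),
      aA f (x.2 ^ x.1.factorization x.2) * c (x.2 ^ x.1.factorization x.2) *
        aA f (x.1 / x.2 ^ x.1.factorization x.2) =
      ∑ y ∈ ((Finset.Icc 1 N).sigma (fun b => b.primeFactors)).image φ, F y := by
    rw [Finset.sum_image hinj]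
  rw [e]
  refine Finset.sum_le_sum_of_subset_of_nonneg ?_ fun y _ _ =>
    mul_nonneg (mul_nonneg (aA_nonneg f _) (hc _)) (aA_nonneg f _)
  intro y hy
  obtain ⟨x, hx, rfl⟩ := Finset.mem_image.mp hy
  obtain ⟨hb, hp, hk⟩ := hmem _ hx
  have hle : x.2 ^ x.1.factorization x.2 ≤ x.1 := Nat.ordProj_le _ (by omega)
  have hpos : 0 < x.2 ^ x.1.factorization x.2 := Nat.pow_pos hp.pos
  simp only [hφ, Finset.mem_product, Finset.mem_filter, Finset.mem_Icc]
  refine ⟨⟨⟨hpos, hle.trans hb.2⟩, hp.isPrimePow.pow hk⟩, Nat.div_pos hle hpos, ?_⟩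
  exact (Nat.div_le_self _ _).trans hb.2

lemma geom_prime {p : ℕ} (hp : p.Prime) :
    Summable (fun n : ℕ => ((1 : ℝ) / p) ^ n) ∧ ∑' n : ℕ, ((1 : ℝ) / p) ^ n = (1 - 1 / (p:ℝ))⁻¹ ∧
    0 < 1 / (p : ℝ) ∧ 1 / (p : ℝ) ≤ 1 / 2 := by
  have h2 : (2 : ℝ) ≤ p := by exact_mod_cast hp.two_le
  have h0 : 0 < 1 / (p : ℝ) := by positivity
  have hh : 1 / (p : ℝ) ≤ 1 / 2 := one_div_le_one_div_of_le (by norm_num) h2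
  exact ⟨summable_geometric_of_lt_one h0.le (by linarith),
    tsum_geometric_of_lt_one h0.le (by linarith), h0, hh⟩

lemma aA_pow_le (f : ℕ → ℝ) {p : ℕ} (hp : p.Prime) (n : ℕ) : aA f (p ^ n) ≤ (1 / (p : ℝ)) ^ n := by
  unfold aA
  rw [one_div_pow]
  push_cast
  have : (0:ℝ) < (p:ℝ) ^ n := by have := hp.pos; positivity
  gcongr
  exact gA_abs f _

lemma aA_pow_summable (f : ℕ → ℝ) {p : ℕ} (hp : p.Prime) : Summable (fun n => aA f (p ^ n)) :=
  Summable.of_nonneg_of_le (fun n => aA_nonneg f _) (aA_pow_le f hp) (geom_prime hp).1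

lemma aA_prime (f : ℕ → ℝ) {p : ℕ} (hp : p.Prime) : aA f p = uf f p / p := by
  unfold aA; rw [gA_prime f hp]

lemma aA_tsum_pow (f : ℕ → ℝ) {p : ℕ} (hp : p.Prime) :
    ∑' n, aA f (p ^ n) ≤ 1 + (uf f p / p + 2 * (1 / (p:ℝ)) ^ 2) := by
  obtain ⟨hs, ht, h0, hh⟩ := geom_prime hp
  have hsum := aA_pow_summable f hp
  rw [← hsum.sum_add_tsum_nat_add 2]
  have h1 : ∑ i ∈ Finset.range 2, aA f (p ^ i) = 1 + uf f p / p := by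
    simp [Finset.sum_range_succ, aA_one, aA_prime f hp]
  have h2 : ∑' i, aA f (p ^ (i + 2)) ≤ 2 * (1 / (p:ℝ)) ^ 2 := by
    calc ∑' i, aA f (p ^ (i + 2)) ≤ ∑' i, (1 / (p:ℝ)) ^ (i + 2) :=
          ((summable_nat_add_iff 2).mpr hsum).tsum_le_tsum (fun i => aA_pow_le f hp _)
            ((summable_nat_add_iff 2).mpr hs)
      _ = (1 - 1 / (p:ℝ))⁻¹ * (1 / (p:ℝ)) ^ 2 := by
          simp_rw [pow_add]; rw [tsum_mul_right, ht]
      _ ≤ _ := by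
          gcongr
          rw [inv_le_comm₀ (by linarith) (by norm_num)]
          linarith
  rw [h1]; linarith

lemma up_summable (f : ℕ → ℝ)
    (hfin : Summable (fun p : Nat.Primes => if f (p : ℕ) ≠ 0 then (1 : ℝ) / ((p : ℕ) : ℝ) else 0)) :
    Summable (fun p : Nat.Primes => uf f (p:ℕ) / ((p:ℕ):ℝ)) := by
  refine hfin.congr fun p => ?_
  rw [uf_prime f p.2]
  split_ifs <;> simp

lemma sum_primes_le (w : ℕ → ℝ) (hw : ∀ p, 0 ≤ w p) (hS : Summable (fun p : Nat.Primes => w (p:ℕ)))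
    (S : Finset ℕ) (hp : ∀ p ∈ S, p.Prime) : ∑ p ∈ S, w p ≤ ∑' p : Nat.Primes, w (p:ℕ) := by
  have hS' : Summable (Set.indicator {p : ℕ | p.Prime} w) := summable_subtype_iff_indicator.mp hS
  have e : ∑' p : Nat.Primes, w (p:ℕ) = ∑' n, Set.indicator {p : ℕ | p.Prime} w n :=
    tsum_subtype {p : ℕ | p.Prime} w
  rw [e]
  calc ∑ p ∈ S, w p = ∑ p ∈ S, Set.indicator {p : ℕ | p.Prime} w p :=
        Finset.sum_congr rfl fun p h => (Set.indicator_of_mem (show p ∈ {p : ℕ | p.Prime} from hp p h) w).symm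
    _ ≤ _ := hS'.sum_le_tsum S fun p _ => Set.indicator_nonneg (fun p _ => hw p) p

lemma aA_bound (f : ℕ → ℝ)
    (hfin : Summable (fun p : Nat.Primes => if f (p : ℕ) ≠ 0 then (1 : ℝ) / ((p : ℕ) : ℝ) else 0)) :
    ∃ K : ℝ, 0 < K ∧ ∀ N : ℕ, ∑ b ∈ Finset.Icc 1 N, aA f b ≤ K := by
  have hU := up_summable f hfin
  have hS : Summable (fun p : Nat.Primes => uf f (p:ℕ) / ((p:ℕ):ℝ) + 2 * (1 / ((p:ℕ):ℝ)) ^ 2) := by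
    refine hU.add (Summable.mul_left 2 ?_)
    have : Summable (fun n : ℕ => (1 / (n : ℝ)) ^ 2) := by
      simpa [one_div_pow] using Real.summable_one_div_nat_pow.mpr (by norm_num : 1 < 2)
    exact this.comp_injective Subtype.val_injective
  refine ⟨Real.exp (∑' p : Nat.Primes, (uf f (p:ℕ) / ((p:ℕ):ℝ) + 2 * (1 / ((p:ℕ):ℝ)) ^ 2)),
    Real.exp_pos _, fun N => ?_⟩
  obtain ⟨hs, hh⟩ := EulerProduct.summable_and_hasSum_smoothNumbers_prod_primesBelow_tsum
    (f := aA f) (aA_one f) (fun {m n} h => aA_mul f h)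
    (fun {p} hp => (aA_pow_summable f hp).congr fun n => by
      rw [Real.norm_of_nonneg (aA_nonneg f _)]) (N + 1)
  have h1 : ∑ b ∈ Finset.Icc 1 N, aA f b ≤ ∑' m : (N + 1).smoothNumbers, aA f m := by
    have hmem : ∀ b ∈ Finset.Icc 1 N, b ∈ (N + 1).smoothNumbers := by
      intro b hb
      rw [Finset.mem_Icc] at hb
      exact Nat.mem_smoothNumbers_of_lt (by omega) (by omega)
    rw [← Finset.sum_attach]
    have := hh.summable.sum_le_tsum
      ((Finset.Icc 1 N).attach.image (fun b => (⟨b.1, hmem b.1 b.2⟩ : (N + 1).smoothNumbers)))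
      (fun _ _ => aA_nonneg f _)
    rw [Finset.sum_image] at this
    · exact this
    · intro a _ b _ h
      have := congrArg (fun q : (N + 1).smoothNumbers => (q : ℕ)) h
      exact Subtype.ext this
  refine h1.trans ?_
  rw [hh.tsum_eq]
  set w : ℕ → ℝ := fun p => uf f p / p + 2 * (1 / (p:ℝ)) ^ 2 with hw
  have hwn : ∀ p, 0 ≤ w p := fun p => by
    have := (uf_mem f p).1
    simp only [hw]; positivity
  calc ∏ p ∈ (N + 1).primesBelow, ∑' n : ℕ, aA f (p ^ n)
      ≤ ∏ p ∈ (N + 1).primesBelow, Real.exp (w p) := by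
        refine Finset.prod_le_prod (fun p _ => tsum_nonneg fun n => aA_nonneg f _) fun p hp => ?_
        have hpp := Nat.prime_of_mem_primesBelow hp
        refine (aA_tsum_pow f hpp).trans ?_
        rw [add_comm]
        exact Real.add_one_le_exp _
    _ = Real.exp (∑ p ∈ (N + 1).primesBelow, w p) := (Real.exp_sum _ _).symm
    _ ≤ _ := by
        refine Real.exp_le_exp.mpr ?_
        exact sum_primes_le w hwn hS _ fun p hp => Nat.prime_of_mem_primesBelow hp

lemma aA_summable (f : ℕ → ℝ)
    (hfin : Summable (fun p : Nat.Primes => if f (p : ℕ) ≠ 0 then (1 : ℝ) / ((p : ℕ) : ℝ) else 0)) :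
    Summable (aA f) := by
  obtain ⟨K, _, hK⟩ := aA_bound f hfin
  refine summable_of_sum_range_le (c := K) (aA_nonneg f) fun n => ?_
  refine le_trans ?_ (hK n)
  rw [← Finset.sum_subset (s₁ := (Finset.range n).erase 0) (Finset.erase_subset _ _)]
  · refine Finset.sum_le_sum_of_subset_of_nonneg ?_ fun _ _ _ => aA_nonneg f _
    intro x hx
    simp only [Finset.mem_erase, Finset.mem_range, Finset.mem_Icc] at hx ⊢
    omega
  · intro x hx hx'
    have : x = 0 := by
      simp only [Finset.mem_erase, Finset.mem_range] at hx hx'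
      tauto
    rw [this, aA_zero]

/-! ### The main term -/

lemma gA_tsum_pow (f : ℕ → ℝ) {p : ℕ} (hp : p.Prime) :
    ∑' n, gA f (p ^ n) / ((p ^ n : ℕ) : ℝ) = 1 - wp f p := by
  obtain ⟨hs, ht, h0, hh⟩ := geom_prime hp
  set x : ℝ := 1 / (p : ℝ) with hx
  have hv : Summable (fun n => vf f (p ^ n) * x ^ n) :=
    Summable.of_nonneg_of_le (fun n => mul_nonneg (vf_mem f _).1 (pow_nonneg h0.le _))
      (fun n => mul_le_of_le_one_left (pow_nonneg h0.le _) (vf_mem f _).2) hs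
  have hu : Summable (fun n => uf f (p ^ (n + 1)) * x ^ (n + 1)) :=
    Summable.of_nonneg_of_le (fun n => mul_nonneg (uf_mem f _).1 (pow_nonneg h0.le _))
      (fun n => mul_le_of_le_one_left (pow_nonneg h0.le _) (uf_mem f _).2)
      ((summable_nat_add_iff 1).mpr hs)
  have hg : ∀ n, gA f (p ^ n) / ((p ^ n : ℕ) : ℝ) = gA f (p ^ n) * x ^ n := fun n => by
    rw [hx, one_div_pow]; push_cast; ring
  simp_rw [hg]
  have hgs : Summable (fun n => gA f (p ^ n) * x ^ n) := by
    refine Summable.of_norm_bounded hs fun n => ?_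
    rw [norm_mul, Real.norm_of_nonneg (pow_nonneg h0.le n)]
    exact mul_le_of_le_one_left (pow_nonneg h0.le _) (gA_abs f _)
  rw [hgs.tsum_eq_zero_add]
  have hv1 := (summable_nat_add_iff 1).mpr hv
  have e1 : ∑' n, gA f (p ^ (n + 1)) * x ^ (n + 1) =
      ∑' n, vf f (p ^ (n + 1)) * x ^ (n + 1) - x * ∑' n, vf f (p ^ n) * x ^ n := by
    rw [← tsum_mul_left, ← hv1.tsum_sub (hv.mul_left x)]
    refine tsum_congr fun n => ?_
    rw [gA_pow f hp]; ring
  have e2 : ∑' n, vf f (p ^ n) * x ^ n = 1 + ∑' n, vf f (p ^ (n + 1)) * x ^ (n + 1) := by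
    rw [hv.tsum_eq_zero_add]; simp [vf_one]
  have e3 : ∑' n, vf f (p ^ (n + 1)) * x ^ (n + 1) =
      ∑' n, x ^ (n + 1) - ∑' n, uf f (p ^ (n + 1)) * x ^ (n + 1) := by
    rw [← ((summable_nat_add_iff 1).mpr hs).tsum_sub hu]
    refine tsum_congr fun n => ?_
    rw [vf_pow f hp]; ring
  have e4 : ∑' n, x ^ (n + 1) = (1 - x)⁻¹ - 1 := by
    have := hs.tsum_eq_zero_add
    rw [ht] at this
    simp at this ⊢; linarith
  have e5 : wp f p = (1 - x) * ∑' n, uf f (p ^ (n + 1)) * x ^ (n + 1) := by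
    unfold wp
    congr 1
    refine tsum_congr fun n => ?_
    rw [hx, one_div_pow]; ring
  rw [e1, e2, e3, e4, e5]
  have : (1 - x) ≠ 0 := by linarith
  simp [(gA_mult f).map_one]
  field_simp
  ring

lemma wp_le (f : ℕ → ℝ) {p : ℕ} (hp : p.Prime) : wp f p ≤ 1 / 2 := by
  obtain ⟨hs, ht, h0, hh⟩ := geom_prime hp
  set x : ℝ := 1 / (p : ℝ) with hx
  have h1 : ∑' n, uf f (p ^ (n + 1)) / (p:ℝ) ^ (n + 1) ≤ ∑' n, x ^ (n + 1) := by
    have hle : ∀ n, uf f (p ^ (n + 1)) / (p:ℝ) ^ (n + 1) ≤ x ^ (n + 1) := fun n => by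
      rw [hx, one_div_pow]
      gcongr
      exact (uf_mem f _).2
    refine Summable.tsum_le_tsum hle ?_ ((summable_nat_add_iff 1).mpr hs)
    exact Summable.of_nonneg_of_le (fun n => div_nonneg (uf_mem f _).1 (by positivity)) hle
      ((summable_nat_add_iff 1).mpr hs)
  have e4 : ∑' n, x ^ (n + 1) = (1 - x)⁻¹ - 1 := by
    have := hs.tsum_eq_zero_add
    rw [ht] at this
    simp at this ⊢; linarith
  rw [e4] at h1
  have hpos : 0 < 1 - x := by linarith
  calc wp f p ≤ (1 - x) * ((1 - x)⁻¹ - 1) := mul_le_mul_of_nonneg_left h1 hpos.le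
    _ = x := by field_simp; ring
    _ ≤ 1 / 2 := hh

def Fm (f : ℕ → ℝ) (m n : ℕ) : ℝ := if Nat.Coprime n m then gA f n / n else 0

lemma Fm_abs_le (f : ℕ → ℝ) (m n : ℕ) : |Fm f m n| ≤ aA f n := by
  unfold Fm
  split_ifs
  · rw [abs_div]; simp [aA]
  · simpa using aA_nonneg f n

lemma main_term (f : ℕ → ℝ)
    (hfin : Summable (fun p : Nat.Primes => if f (p : ℕ) ≠ 0 then (1 : ℝ) / ((p : ℕ) : ℝ) else 0))
    {m : ℕ} (hm : m ≠ 0) :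
    (∏' p : Nat.Primes, (1 - wp f (p : ℕ))) * hf f m = uf f m * (Dm m * ∑' n, Fm f m n) := by
  have hsum : Summable (fun n => ‖Fm f m n‖) :=
    Summable.of_nonneg_of_le (fun _ => norm_nonneg _) (fun n => Fm_abs_le f m n) (aA_summable f hfin)
  have hP := EulerProduct.eulerProduct_hasProd (f := Fm f m)
    (by simp [Fm, (gA_mult f).map_one])
    (fun {a b} hab => by
      unfold Fm
      by_cases h1 : Nat.Coprime a m
      · by_cases h2 : Nat.Coprime b m
        · rw [if_pos h1, if_pos h2, if_pos (h1.mul_left h2), (gA_mult f).map_mul_of_coprime hab]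
          push_cast
          rw [mul_div_mul_comm]
        · rw [if_neg h2, if_neg (fun h => h2 (Nat.coprime_mul_iff_left.mp h).2), mul_zero]
      · rw [if_neg h1, if_neg (fun h => h1 (Nat.coprime_mul_iff_left.mp h).1), zero_mul])
    hsum (by simp [Fm])
  have hfac : ∀ p : Nat.Primes, ∑' e, Fm f m ((p:ℕ) ^ e) = if (p:ℕ) ∈ m.primeFactors then 1 else 1 - wp f (p:ℕ) := by
    intro p
    have hp := p.2
    split_ifs with h
    · have hdvd := Nat.dvd_of_mem_primeFactors h
      rw [tsum_eq_single 0]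
      · simp [Fm, (gA_mult f).map_one]
      · intro e he
        unfold Fm
        rw [if_neg]
        intro hc
        have := Nat.Coprime.eq_one_of_dvd ((Nat.coprime_pow_left_iff (Nat.pos_of_ne_zero he) _ _).mp hc) hdvd
        exact hp.one_lt.ne' this
    · have hc : Nat.Coprime (p:ℕ) m := by
        rw [hp.coprime_iff_not_dvd]
        intro hd
        exact h (Nat.mem_primeFactors.mpr ⟨hp, hd, hm⟩)
      rw [← gA_tsum_pow f hp]
      refine tsum_congr fun e => ?_
      unfold Fm
      rw [if_pos (hc.pow_left e)]
  simp_rw [hfac] at hP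
  have hQ : HasProd (fun p : Nat.Primes => if (p:ℕ) ∈ m.primeFactors then 1 - wp f (p:ℕ) else 1)
      (∏ p ∈ m.primeFactors, (1 - wp f p)) := by
    have h1 : HasProd (Set.mulIndicator {p : ℕ | p.Prime} (fun p : ℕ => if p ∈ m.primeFactors then 1 - wp f p else 1))
        (∏ p ∈ m.primeFactors, (Set.mulIndicator {p : ℕ | p.Prime} (fun p : ℕ => if p ∈ m.primeFactors then 1 - wp f p else 1)) p) := by
      apply hasProd_prod_of_ne_finset_one
      intro p hp
      rw [Set.mulIndicator_apply]
      simp [hp]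
    have h2 := hasProd_subtype_iff_mulIndicator.mpr h1
    have e : ∏ p ∈ m.primeFactors, (Set.mulIndicator {p : ℕ | p.Prime} (fun p : ℕ => if p ∈ m.primeFactors then 1 - wp f p else 1)) p = ∏ p ∈ m.primeFactors, (1 - wp f p) := by
      refine Finset.prod_congr rfl fun p hp => ?_
      rw [Set.mulIndicator_of_mem (show p ∈ {p : ℕ | p.Prime} from Nat.prime_of_mem_primeFactors hp), if_pos hp]
    rw [e] at h2
    exact h2
  have hR := hP.mul hQ
  have hE : (fun p : Nat.Primes => (if (p:ℕ) ∈ m.primeFactors then (1:ℝ) else 1 - wp f (p:ℕ)) *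
      (if (p:ℕ) ∈ m.primeFactors then 1 - wp f (p:ℕ) else 1)) = fun p : Nat.Primes => 1 - wp f (p:ℕ) := by
    funext p; split_ifs <;> ring
  rw [hE] at hR
  rw [hR.tprod_eq]
  unfold hf Dm
  rw [Finset.prod_div_distrib]
  have hne : ∏ p ∈ m.primeFactors, (1 - wp f p) ≠ 0 := by
    rw [Finset.prod_ne_zero_iff]
    intro p hp
    have := wp_le f (Nat.prime_of_mem_primeFactors hp)
    linarith
  field_simp

/-! ### α and β -/

lemma alpha_anti (f : ℕ → ℝ)
    (hfin : Summable (fun p : Nat.Primes => if f (p : ℕ) ≠ 0 then (1 : ℝ) / ((p : ℕ) : ℝ) else 0)) :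
    Antitone (alphaf f) ∧ (∀ y, 0 ≤ alphaf f y) ∧
    (∀ y, Summable (fun p : Nat.Primes => if y < ((p : ℕ) : ℝ) then uf f (p : ℕ) / ((p : ℕ) : ℝ) else 0)) ∧
    (∀ y, alphaf f y ≤ ∑' p : Nat.Primes, uf f (p : ℕ) / ((p : ℕ) : ℝ)) := by
  have hU := up_summable f hfin
  have hn : ∀ p : ℕ, 0 ≤ uf f p / (p:ℝ) := fun p => div_nonneg (uf_mem f _).1 (by positivity)
  have hs : ∀ y : ℝ, Summable (fun p : Nat.Primes => if y < ((p : ℕ) : ℝ) then uf f (p : ℕ) / ((p : ℕ) : ℝ) else 0) :=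
    fun y => Summable.of_nonneg_of_le (fun p => by split_ifs; exacts [hn _, le_rfl])
      (fun p => by split_ifs; exacts [le_rfl, hn _]) hU
  refine ⟨fun y z h => ?_, fun y => tsum_nonneg fun p => by split_ifs; exacts [hn _, le_rfl], hs, fun y => ?_⟩
  · refine Summable.tsum_le_tsum (fun p => ?_) (hs z) (hs y)
    by_cases h1 : z < ((p:ℕ):ℝ)
    · rw [if_pos h1, if_pos (h.trans_lt h1)]
    · rw [if_neg h1]; split_ifs; exacts [hn _, le_rfl]
  · exact Summable.tsum_le_tsum (fun p => by split_ifs; exacts [le_rfl, hn _]) (hs y) hU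

lemma alpha_intble (f : ℕ → ℝ)
    (hfin : Summable (fun p : Nat.Primes => if f (p : ℕ) ≠ 0 then (1 : ℝ) / ((p : ℕ) : ℝ) else 0))
    {t : ℝ} (ht : 1 ≤ t) : IntervalIntegrable (fun y => alphaf f y / y) volume 1 t := by
  simp_rw [div_eq_mul_inv]
  refine IntervalIntegrable.mul_continuousOn ((alpha_anti f hfin).1.intervalIntegrable) ?_
  refine continuousOn_id.inv₀ fun y hy => ?_
  rw [Set.uIcc_of_le ht] at hy
  simp only [id]; linarith [hy.1]

lemma int_ind {p t : ℝ} (hp : 1 ≤ p) (hpt : p ≤ t) :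
    IntervalIntegrable (fun y => if y < p then 1 / y else 0) volume 1 t ∧
    ∫ y in (1:ℝ)..t, (if y < p then 1 / y else 0) = Real.log p := by
  have e : (fun y : ℝ => if y < p then 1 / y else 0) = Set.indicator (Set.Iio p) (fun y => 1 / y) := by
    funext y; simp [Set.indicator_apply]
  have hii : IntervalIntegrable (fun y : ℝ => 1 / y) volume 1 t := by
    apply intervalIntegral.intervalIntegrable_one_div
    · intro y hy; rw [Set.uIcc_of_le (hp.trans hpt)] at hy; linarith [hy.1]
    · exact continuousOn_id
  rw [e]
  constructor
  · rw [intervalIntegrable_iff_integrableOn_Ioc_of_le (hp.trans hpt)] at hii ⊢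
    exact hii.indicator measurableSet_Iio
  · rw [intervalIntegral.integral_of_le (hp.trans hpt), setIntegral_indicator measurableSet_Iio]
    have : Set.Ioc 1 t ∩ Set.Iio p = Set.Ioo 1 p := by
      ext y; simp only [Set.mem_inter_iff, Set.mem_Ioc, Set.mem_Iio, Set.mem_Ioo]
      constructor
      · rintro ⟨⟨a, b⟩, c⟩; exact ⟨a, c⟩
      · rintro ⟨a, c⟩; exact ⟨⟨a, by linarith⟩, c⟩
    rw [this, ← integral_Ioc_eq_integral_Ioo, ← intervalIntegral.integral_of_le hp,
      integral_one_div_of_pos one_pos (by linarith), div_one]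

lemma beta_lower (f : ℕ → ℝ)
    (hfin : Summable (fun p : Nat.Primes => if f (p : ℕ) ≠ 0 then (1 : ℝ) / ((p : ℕ) : ℝ) else 0))
    {t : ℝ} (ht : 1 < t) :
    ∑ p ∈ (Finset.Icc 1 ⌊t⌋₊).filter Nat.Prime, uf f p / p * Real.log p ≤ Real.log t * betaf f t := by
  have hlog := Real.log_pos ht
  unfold betaf
  rw [← mul_assoc, mul_one_div_cancel hlog.ne', one_mul]
  have hmem : ∀ p ∈ (Finset.Icc 1 ⌊t⌋₊).filter Nat.Prime, (1:ℝ) ≤ p ∧ (p:ℝ) ≤ t := fun p hp => by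
    rw [Finset.mem_filter, Finset.mem_Icc] at hp
    exact ⟨by exact_mod_cast hp.1.1, (Nat.le_floor_iff (by linarith)).mp hp.1.2⟩
  have e : ∑ p ∈ (Finset.Icc 1 ⌊t⌋₊).filter Nat.Prime, uf f p / p * Real.log p =
      ∫ y in (1:ℝ)..t, ∑ p ∈ (Finset.Icc 1 ⌊t⌋₊).filter Nat.Prime,
        uf f p / p * (if y < (p:ℝ) then 1 / y else 0) := by
    rw [intervalIntegral.integral_finsetSum]
    · refine Finset.sum_congr rfl fun p hp => ?_
      rw [intervalIntegral.integral_const_mul, (int_ind (hmem p hp).1 (hmem p hp).2).2]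
    · intro p hp
      exact (int_ind (hmem p hp).1 (hmem p hp).2).1.const_mul _
  rw [e]
  refine intervalIntegral.integral_mono_on ht.le ?_ (alpha_intble f hfin ht.le) ?_
  · have := IntervalIntegrable.sum ((Finset.Icc 1 ⌊t⌋₊).filter Nat.Prime)
      (f := fun (p:ℕ) (y:ℝ) => uf f p / p * (if y < (p:ℝ) then 1 / y else 0)) (μ := volume) (a := 1) (b := t)
      fun p hp => (int_ind (hmem p hp).1 (hmem p hp).2).1.const_mul _
    rw [Finset.sum_fn] at this
    exact this
  · intro y hy
    have hy0 : 0 < y := by linarith [hy.1]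
    have : ∑ p ∈ (Finset.Icc 1 ⌊t⌋₊).filter Nat.Prime, uf f p / p * (if y < (p:ℝ) then 1 / y else 0) =
        (∑ p ∈ (Finset.Icc 1 ⌊t⌋₊).filter Nat.Prime, if y < (p:ℝ) then uf f p / p else 0) / y := by
      rw [Finset.sum_div]
      refine Finset.sum_congr rfl fun p _ => ?_
      split_ifs <;> ring
    rw [this]
    gcongr
    exact sum_primes_le (fun p => if y < (p:ℝ) then uf f p / p else 0)
      (fun p => by
        split_ifs
        exacts [div_nonneg (uf_mem f _).1 (by positivity), le_rfl])
      ((alpha_anti f hfin).2.2.1 y) _ (fun p hp => (Finset.mem_filter.mp hp).2)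

lemma beta_upper (f : ℕ → ℝ)
    (hfin : Summable (fun p : Nat.Primes => if f (p : ℕ) ≠ 0 then (1 : ℝ) / ((p : ℕ) : ℝ) else 0))
    {t : ℝ} (ht : 1 < t) :
    0 ≤ betaf f t ∧ betaf f t ≤ ∑' p : Nat.Primes, uf f (p : ℕ) / ((p : ℕ) : ℝ) := by
  have hlog := Real.log_pos ht
  obtain ⟨h1, h2, h3, h4⟩ := alpha_anti f hfin
  set A := ∑' p : Nat.Primes, uf f (p : ℕ) / ((p : ℕ) : ℝ)
  unfold betaf
  constructor
  · refine mul_nonneg (by positivity) (intervalIntegral.integral_nonneg ht.le fun y hy => ?_)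
    exact div_nonneg (h2 y) (by linarith [hy.1])
  · have hii : IntervalIntegrable (fun y : ℝ => A * (1 / y)) volume 1 t := by
      refine IntervalIntegrable.const_mul ?_ A
      apply intervalIntegral.intervalIntegrable_one_div
      · intro y hy; rw [Set.uIcc_of_le ht.le] at hy; linarith [hy.1]
      · exact continuousOn_id
    have : ∫ y in (1:ℝ)..t, alphaf f y / y ≤ ∫ y in (1:ℝ)..t, A * (1 / y) := by
      refine intervalIntegral.integral_mono_on ht.le (alpha_intble f hfin ht.le) hii fun y hy => ?_
      have hy0 : 0 < y := by linarith [hy.1]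
      rw [mul_one_div]
      gcongr
      exact h4 y
    rw [intervalIntegral.integral_const_mul, integral_one_div_of_pos one_pos (by linarith), div_one] at this
    rw [one_div, inv_mul_le_iff₀ hlog]
    linarith

/-! ### Proper prime powers and the final estimate -/

lemma pp_bound : ∃ B : ℝ, 0 ≤ B ∧ ∀ N : ℕ,
    ∑ q ∈ (Finset.Icc 1 N).filter (fun q => IsPrimePow q ∧ ¬ q.Prime), Real.log q / q ≤ B := by
  set ρ : ℝ := (2:ℝ) ^ (-(3/4) : ℝ) with hρ
  have hρ0 : 0 < ρ := by positivity
  have hρ1 : ρ < 1 := Real.rpow_lt_one_of_one_lt_of_neg (by norm_num) (by norm_num)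
  have hs1 : Summable (fun n : ℕ => (n:ℝ) ^ (-(3/2) : ℝ)) := by
    rw [Real.summable_nat_rpow]; norm_num
  have hs2 : Summable (fun j : ℕ => ρ ^ j) := summable_geometric_of_lt_one hρ0.le hρ1
  have hs : Summable (fun x : ℕ × ℕ => (x.1:ℝ) ^ (-(3/2) : ℝ) * ρ ^ x.2) :=
    hs1.mul_of_nonneg hs2 (fun n => by positivity) (fun n => by positivity)
  have hnn : ∀ x : ℕ × ℕ, 0 ≤ (x.1:ℝ) ^ (-(3/2) : ℝ) * ρ ^ x.2 := fun x => by positivity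
  refine ⟨4 * ∑' x : ℕ × ℕ, (x.1:ℝ) ^ (-(3/2) : ℝ) * ρ ^ x.2,
    mul_nonneg (by norm_num) (tsum_nonneg hnn), fun N => ?_⟩
  have hrep : ∀ q : ℕ, IsPrimePow q ∧ ¬ q.Prime → ∃ x : ℕ × ℕ, x.1.Prime ∧ x.1 ^ (x.2 + 2) = q := by
    rintro q ⟨hq, hnp⟩
    obtain ⟨p, k, hp, hk, rfl⟩ := (isPrimePow_nat_iff q).mp hq
    have : k ≠ 1 := by rintro rfl; simp [hp] at hnp
    exact ⟨(p, k - 2), hp, by simp only; congr 1; omega⟩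
  choose! φ hφ using hrep
  have hinj : Set.InjOn φ ((Finset.Icc 1 N).filter (fun q => IsPrimePow q ∧ ¬ q.Prime)) := by
    intro a ha b hb h
    rw [← (hφ a (Finset.mem_filter.mp ha).2).2, ← (hφ b (Finset.mem_filter.mp hb).2).2, h]
  calc _ ≤ ∑ q ∈ (Finset.Icc 1 N).filter (fun q => IsPrimePow q ∧ ¬ q.Prime),
        4 * (((φ q).1:ℝ) ^ (-(3/2) : ℝ) * ρ ^ (φ q).2) := by
        refine Finset.sum_le_sum fun q hq => ?_
        obtain ⟨hp, he⟩ := hφ q (Finset.mem_filter.mp hq).2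
        set p := (φ q).1
        set j := (φ q).2
        have hp2 : (2:ℝ) ≤ p := by exact_mod_cast hp.two_le
        have hp0 : (0:ℝ) < p := by linarith
        have hq0 : (0:ℝ) < q := by rw [← he]; push_cast; positivity
        have hl := Real.log_le_rpow_div hq0.le (show (0:ℝ) < 1/4 by norm_num)
        have h1 : Real.log q / q ≤ 4 * (q:ℝ) ^ (-(3/4) : ℝ) := by
          rw [div_le_iff₀ hq0, mul_assoc]
          have : (q:ℝ) ^ (-(3/4) : ℝ) * q = (q:ℝ) ^ (1/4 : ℝ) := by
            nth_rw 2 [← Real.rpow_one (q:ℝ)]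
            rw [← Real.rpow_add hq0]; norm_num
          rw [this]
          linarith
        refine h1.trans ?_
        have h2 : (q:ℝ) ^ (-(3/4) : ℝ) = (p:ℝ) ^ (-(3/2) : ℝ) * ((p:ℝ) ^ (-(3/4) : ℝ)) ^ j := by
          rw [← he]
          push_cast
          rw [← Real.rpow_natCast, ← Real.rpow_natCast, ← Real.rpow_mul hp0.le, ← Real.rpow_mul hp0.le,
            ← Real.rpow_add hp0]
          congr 1
          push_cast; ring
        rw [h2]
        gcongr
        exact Real.rpow_le_rpow_of_nonpos (by norm_num) hp2 (by norm_num)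
    _ = 4 * ∑ q ∈ (Finset.Icc 1 N).filter (fun q => IsPrimePow q ∧ ¬ q.Prime),
        (((φ q).1:ℝ) ^ (-(3/2) : ℝ) * ρ ^ (φ q).2) := by rw [Finset.mul_sum]
    _ ≤ _ := by
        gcongr
        rw [← Finset.sum_image (f := fun x : ℕ × ℕ => (x.1:ℝ) ^ (-(3/2) : ℝ) * ρ ^ x.2) hinj]
        exact hs.sum_le_tsum _ fun x _ => hnn x

def cc (t : ℝ) (n : ℕ) : ℝ := min 1 (4 * Real.log n / Real.log t)

lemma cc_nonneg {t : ℝ} (ht : 1 < t) (n : ℕ) : 0 ≤ cc t n := by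
  have := Real.log_pos ht
  have := Real.log_natCast_nonneg n
  unfold cc; positivity

lemma cc_sub {t : ℝ} (ht : 1 < t) (m n : ℕ) (hm : 0 < m) (hn : 0 < n) :
    cc t (m * n) ≤ cc t m + cc t n := by
  have h0 := Real.log_pos ht
  have a := cc_nonneg ht m
  have b := cc_nonneg ht n
  have e : 4 * Real.log ((m * n : ℕ) : ℝ) / Real.log t =
      4 * Real.log m / Real.log t + 4 * Real.log n / Real.log t := by
    push_cast
    rw [Real.log_mul (by exact_mod_cast hm.ne') (by exact_mod_cast hn.ne')]; ring
  rcases le_total 1 (4 * Real.log m / Real.log t) with h1 | h1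
  · have : cc t m = 1 := min_eq_left h1
    have : cc t (m * n) ≤ 1 := min_le_left _ _
    linarith
  rcases le_total 1 (4 * Real.log n / Real.log t) with h2 | h2
  · have : cc t n = 1 := min_eq_left h2
    have : cc t (m * n) ≤ 1 := min_le_left _ _
    linarith
  · have e1 : cc t m = _ := min_eq_right h1
    have e2 : cc t n = _ := min_eq_right h2
    rw [e1, e2, ← e]
    exact min_le_right _ _

lemma tail_bound (f : ℕ → ℝ)
    (hfin : Summable (fun p : Nat.Primes => if f (p : ℕ) ≠ 0 then (1 : ℝ) / ((p : ℕ) : ℝ) else 0))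
    {B : ℝ} (hB : ∀ N : ℕ,
      ∑ q ∈ (Finset.Icc 1 N).filter (fun q => IsPrimePow q ∧ ¬ q.Prime), Real.log q / q ≤ B)
    {t : ℝ} (ht : 1 < t) (N : ℕ) :
    ∑ q ∈ (Finset.Icc 1 N).filter IsPrimePow, aA f q * cc t q ≤
      alphaf f t + 4 * betaf f t + 4 * B / Real.log t := by
  have h0 := Real.log_pos ht
  have hn : ∀ p : ℕ, 0 ≤ uf f p / (p:ℝ) := fun p => div_nonneg (uf_mem f _).1 (by positivity)
  rw [← Finset.sum_filter_add_sum_filter_not _ Nat.Prime, Finset.filter_filter, Finset.filter_filter]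
  have hprime : (Finset.Icc 1 N).filter (fun q => IsPrimePow q ∧ q.Prime) = (Finset.Icc 1 N).filter Nat.Prime := by
    refine Finset.filter_congr fun q _ => ⟨fun h => h.2, fun h => ⟨h.isPrimePow, h⟩⟩
  rw [hprime]
  have hA : ∑ q ∈ (Finset.Icc 1 N).filter Nat.Prime, aA f q * cc t q ≤ alphaf f t + 4 * betaf f t := by
    have h1 : ∀ q ∈ (Finset.Icc 1 N).filter Nat.Prime, aA f q * cc t q ≤
        (if t < (q:ℝ) then uf f q / q else 0) +
        (4 / Real.log t) * (if (q:ℝ) ≤ t then uf f q / q * Real.log q else 0) := by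
      intro q hq
      rw [aA_prime f (Finset.mem_filter.mp hq).2]
      by_cases h : t < (q:ℝ)
      · rw [if_pos h, if_neg (not_le.mpr h), mul_zero, add_zero]
        exact mul_le_of_le_one_right (hn q) (min_le_left _ _)
      · rw [if_neg h, if_pos (not_lt.mp h), zero_add]
        calc _ ≤ uf f q / q * (4 * Real.log q / Real.log t) :=
              mul_le_mul_of_nonneg_left (min_le_right _ _) (hn q)
          _ = _ := by ring
    refine (Finset.sum_le_sum h1).trans ?_
    rw [Finset.sum_add_distrib, ← Finset.mul_sum]
    refine add_le_add ?_ ?_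
    · exact sum_primes_le (fun p => if t < (p:ℝ) then uf f p / p else 0)
        (fun p => by split_ifs; exacts [hn p, le_rfl])
        ((alpha_anti f hfin).2.2.1 t) _ (fun p hp => (Finset.mem_filter.mp hp).2)
    · have h2 : ∑ q ∈ (Finset.Icc 1 N).filter Nat.Prime, (if (q:ℝ) ≤ t then uf f q / q * Real.log q else 0) ≤
          ∑ p ∈ (Finset.Icc 1 ⌊t⌋₊).filter Nat.Prime, uf f p / p * Real.log p := by
        rw [← Finset.sum_filter]
        refine Finset.sum_le_sum_of_subset_of_nonneg ?_ fun p _ _ => mul_nonneg (hn p) (Real.log_natCast_nonneg p)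
        intro p hp
        simp only [Finset.mem_filter, Finset.mem_Icc] at hp ⊢
        exact ⟨⟨hp.1.1.1, Nat.le_floor hp.2⟩, hp.1.2⟩
      have h3 := h2.trans (beta_lower f hfin ht)
      calc _ ≤ (4 / Real.log t) * (Real.log t * betaf f t) := by gcongr
        _ = _ := by field_simp
  have hC : ∑ q ∈ (Finset.Icc 1 N).filter (fun q => IsPrimePow q ∧ ¬ q.Prime), aA f q * cc t q ≤
      4 * B / Real.log t := by
    calc _ ≤ ∑ q ∈ (Finset.Icc 1 N).filter (fun q => IsPrimePow q ∧ ¬ q.Prime),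
          (4 / Real.log t) * (Real.log q / q) := by
          refine Finset.sum_le_sum fun q hq => ?_
          have h1 : aA f q ≤ 1 / q := by
            unfold aA; gcongr; exact gA_abs f q
          calc aA f q * cc t q ≤ (1 / q) * (4 * Real.log q / Real.log t) :=
                mul_le_mul h1 (min_le_right _ _) (cc_nonneg ht q) (by positivity)
            _ = _ := by ring
      _ = (4 / Real.log t) * ∑ q ∈ (Finset.Icc 1 N).filter (fun q => IsPrimePow q ∧ ¬ q.Prime), Real.log q / q := by
          rw [Finset.mul_sum]
      _ ≤ (4 / Real.log t) * B := by gcongr; exact hB N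
      _ = _ := by ring
  linarith

/-- Pointwise error. -/
def Eb (f : ℕ → ℝ) (m : ℕ) (t : ℝ) (b : ℕ) : ℝ :=
  if Nat.Coprime b m then gA f b * (Phi m (t / b) - t / b * Dm m) else 0

lemma Eb_le1 (f : ℕ → ℝ) (m : ℕ) {t : ℝ} (ht : 0 ≤ t) (b : ℕ) : |Eb f m t b| ≤ t * aA f b := by
  unfold Eb
  have hx : 0 ≤ t / b := by positivity
  split_ifs
  · rw [abs_mul]
    have h : |Phi m (t / b) - t / b * Dm m| ≤ t / b := by
      have h1 := Phi_le m hx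
      have h2 := Phi_nonneg m (t / b)
      have h3 := Dm_mem m
      have h4 : t / b * Dm m ≤ t / b := mul_le_of_le_one_right hx h3.2
      have h5 : 0 ≤ t / b * Dm m := mul_nonneg hx h3.1
      rw [abs_le]; constructor <;> linarith
    calc _ ≤ |gA f b| * (t / b) := by gcongr
      _ = _ := by unfold aA; ring
  · simpa using mul_nonneg ht (aA_nonneg f b)

lemma Eb_le2 (f : ℕ → ℝ) {m : ℕ} (hm : m ≠ 0) {t : ℝ} (ht : 1 < t) (hmt : (m:ℝ) ≤ t) (b : ℕ) (hb : b ≠ 0) :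
    |Eb f m t b| ≤ (if (b:ℝ) ≤ t ^ (1/4 : ℝ) then 2 * Real.sqrt t else 0) + t * (aA f b * cc t b) := by
  have h0 := Real.log_pos ht
  by_cases h : (b:ℝ) ≤ t ^ (1/4 : ℝ)
  · rw [if_pos h]
    have h1 : |Eb f m t b| ≤ 2 * Real.sqrt t := by
      unfold Eb
      split_ifs
      · rw [abs_mul]
        have h2 := Phi_est hm (show 0 ≤ t / b by positivity)
        have h3 := card_div_le m
        have h4 : Real.sqrt m ≤ Real.sqrt t := Real.sqrt_le_sqrt hmt
        calc _ ≤ 1 * |Phi m (t / b) - t / b * Dm m| := by gcongr; exact gA_abs f b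
          _ ≤ _ := by linarith
      · simp
    have := mul_nonneg (by linarith : 0 ≤ t) (mul_nonneg (aA_nonneg f b) (cc_nonneg ht b))
    linarith
  · rw [if_neg h, zero_add]
    have hc : cc t b = 1 := by
      refine min_eq_left ?_
      rw [one_le_div h0]
      have h2 := Real.log_le_log (by positivity) (not_le.mp h).le
      rw [Real.log_rpow (by linarith)] at h2
      linarith
    rw [hc, mul_one]
    exact Eb_le1 f m (by linarith) b

lemma diff_eq (f : ℕ → ℝ)
    (hfin : Summable (fun p : Nat.Primes => if f (p : ℕ) ≠ 0 then (1 : ℝ) / ((p : ℕ) : ℝ) else 0))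
    (m : ℕ) {t : ℝ} (ht : 0 ≤ t) :
    Summable (Eb f m t) ∧ Vm f m t - t * (Dm m * ∑' n, Fm f m n) = ∑' b, Eb f m t b := by
  have hs : Summable (Eb f m t) :=
    Summable.of_norm_bounded ((aA_summable f hfin).mul_left t) (fun b => Eb_le1 f m ht b)
  have hF : Summable (Fm f m) :=
    Summable.of_norm_bounded (aA_summable f hfin) (fun b => Fm_abs_le f m b)
  refine ⟨hs, ?_⟩
  have h1 : Vm f m t = ∑' b, (if Nat.Coprime b m then gA f b * Phi m (t / b) else 0) := by
    rw [Vm_eq, Finset.sum_filter, tsum_eq_sum]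
    intro b hb
    rw [Finset.mem_Icc, not_and_or] at hb
    rcases hb with hb | hb
    · have : b = 0 := by omega
      subst this; simp
    · have hbt : t < b := by
        rw [not_le] at hb
        exact (Nat.floor_lt ht).mp hb
      have : Phi m (t / b) = 0 := by
        unfold Phi
        have : ⌊t / (b:ℝ)⌋₊ = 0 := by
          rw [Nat.floor_eq_zero, div_lt_one (by linarith)]; exact hbt
        rw [this]; simp
      rw [this]; simp
  have hE : ∀ b, (if Nat.Coprime b m then gA f b * Phi m (t / b) else 0) =
      Eb f m t b + t * Dm m * Fm f m b := by
    intro b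
    unfold Eb Fm
    split_ifs <;> ring
  rw [h1, tsum_congr hE, hs.tsum_add (hF.mul_left _), tsum_mul_left]
  ring

lemma sum_range_le_Icc (F : ℕ → ℝ) (hF : ∀ n, 0 ≤ F n) (h0 : F 0 = 0) (n : ℕ) :
    ∑ b ∈ Finset.range n, F b ≤ ∑ b ∈ Finset.Icc 1 n, F b := by
  rw [← Finset.sum_subset (s₁ := (Finset.range n).erase 0) (Finset.erase_subset _ _)]
  · refine Finset.sum_le_sum_of_subset_of_nonneg ?_ fun _ _ _ => hF _
    intro x hx
    simp only [Finset.mem_erase, Finset.mem_range, Finset.mem_Icc] at hx ⊢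
    omega
  · intro x hx hx'
    have : x = 0 := by
      simp only [Finset.mem_erase, Finset.mem_range] at hx hx'
      tauto
    rw [this, h0]

lemma abs_diff_le (f : ℕ → ℝ)
    (hfin : Summable (fun p : Nat.Primes => if f (p : ℕ) ≠ 0 then (1 : ℝ) / ((p : ℕ) : ℝ) else 0))
    (m : ℕ) {t : ℝ} (ht : 0 ≤ t) (M : ℝ) (hM : ∀ n : ℕ, ∑ b ∈ Finset.Icc 1 n, |Eb f m t b| ≤ M) :
    |Vm f m t - t * (Dm m * ∑' n, Fm f m n)| ≤ M := by
  obtain ⟨hs, he⟩ := diff_eq f hfin m ht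
  rw [he]
  have h1 : |∑' b, Eb f m t b| ≤ ∑' b, |Eb f m t b| := by
    have := norm_tsum_le_tsum_norm hs.norm
    simpa using this
  refine h1.trans (Real.tsum_le_of_sum_range_le (fun _ => abs_nonneg _) fun n => ?_)
  exact (sum_range_le_Icc _ (fun _ => abs_nonneg _) (by simp [Eb]) n).trans (hM n)

/-- The key estimate of Section 3: uniformly for `t ≥ m ≥ 1`,
`u_f(m) V_m(t) = ∏_p (1 − w_p) · t · h_f(m) + O(t u_f(m) R₀(t))` with
`R₀(t) = α_f(t) + β_f(t)^{1/4} + 1/(log 2t)^{1/6}`. -/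
theorem uf_Vm_asymptotic (f : ℕ → ℝ) (hadd : IsAdditive f) (hconv : EWConv f)
    (hfin : Summable (fun p : Nat.Primes => if f (p : ℕ) ≠ 0 then (1 : ℝ) / ((p : ℕ) : ℝ) else 0)) :
    ∃ C : ℝ, 0 < C ∧ ∀ (t : ℝ) (m : ℕ), 1 ≤ t → 1 ≤ m → (m : ℝ) ≤ t →
      |uf f m * Vm f m t - (∏' p : Nat.Primes, (1 - wp f (p : ℕ))) * t * hf f m| ≤
        C * t * uf f m *
          (alphaf f t + betaf f t ^ ((1:ℝ)/4) + 1 / Real.log (2*t) ^ ((1:ℝ)/6)) := by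
  obtain ⟨K, hK0, hK⟩ := aA_bound f hfin
  obtain ⟨B, hB0, hB⟩ := pp_bound
  obtain ⟨-, halpha, -, -⟩ := alpha_anti f hfin
  set A := ∑' p : Nat.Primes, uf f (p : ℕ) / ((p : ℕ) : ℝ) with hA
  have hA0 : 0 ≤ A := tsum_nonneg fun p => div_nonneg (uf_mem f _).1 (by positivity)
  have hA34 : 0 ≤ A ^ ((3:ℝ)/4) := Real.rpow_nonneg hA0 _
  refine ⟨7 * K + 4 * K * A ^ ((3:ℝ)/4) + (16 + 8 * K * B), by positivity, fun t m ht hm hmt => ?_⟩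
  set C := 7 * K + 4 * K * A ^ ((3:ℝ)/4) + (16 + 8 * K * B) with hC
  have hm0 : m ≠ 0 := by omega
  have e : uf f m * Vm f m t - (∏' p : Nat.Primes, (1 - wp f (p : ℕ))) * t * hf f m =
      uf f m * (Vm f m t - t * (Dm m * ∑' n, Fm f m n)) := by
    have := main_term f hfin hm0
    linear_combination (-t) * this
  rw [e, abs_mul, abs_of_nonneg (uf_mem f m).1]
  suffices h : |Vm f m t - t * (Dm m * ∑' n, Fm f m n)| ≤ C * t *
      (alphaf f t + betaf f t ^ ((1:ℝ)/4) + 1 / Real.log (2*t) ^ ((1:ℝ)/6)) by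
    calc _ ≤ uf f m * (C * t *
          (alphaf f t + betaf f t ^ ((1:ℝ)/4) + 1 / Real.log (2*t) ^ ((1:ℝ)/6))) :=
          mul_le_mul_of_nonneg_left h (uf_mem f m).1
      _ = _ := by ring
  have hα := halpha t
  have ht0 : 0 < t := by linarith
  have hL0 : 0 < Real.log (2 * t) := Real.log_pos (by linarith)
  have hβ0 : 0 ≤ betaf f t := by
    rcases ht.eq_or_lt with h | h
    · rw [← h]; simp [betaf]
    · exact (beta_upper f hfin h).1
  have hβ' : 0 ≤ betaf f t ^ ((1:ℝ)/4) := Real.rpow_nonneg hβ0 _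
  have hL' : 0 < Real.log (2 * t) ^ ((1:ℝ)/6) := Real.rpow_pos_of_pos hL0 _
  set β' := betaf f t ^ ((1:ℝ)/4) with hβ'd
  set L' := Real.log (2 * t) ^ ((1:ℝ)/6) with hL'd
  have hiL : 0 < 1 / L' := by positivity
  rcases lt_or_ge t 4 with h4 | h4
  · have h1 : |Vm f m t - t * (Dm m * ∑' n, Fm f m n)| ≤ t * K := by
      refine abs_diff_le f hfin m ht0.le _ fun n => ?_
      calc _ ≤ ∑ b ∈ Finset.Icc 1 n, t * aA f b := Finset.sum_le_sum fun b _ => Eb_le1 f m ht0.le b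
        _ = t * ∑ b ∈ Finset.Icc 1 n, aA f b := by rw [Finset.mul_sum]
        _ ≤ _ := by gcongr; exact hK n
    have h2 : L' ≤ 7 := by
      have h3 : Real.log (2 * t) ≤ 7 := by
        have := Real.log_le_sub_one_of_pos (show 0 < 2 * t by linarith)
        linarith
      calc L' ≤ 7 ^ ((1:ℝ)/6) := Real.rpow_le_rpow hL0.le h3 (by norm_num)
        _ ≤ 7 ^ (1:ℝ) := Real.rpow_le_rpow_of_exponent_le (by norm_num) (by norm_num)
        _ = 7 := Real.rpow_one _
    have h3 : 1 ≤ 7 * (1 / L') := by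
      rw [mul_one_div, one_le_div hL']; exact h2
    calc _ ≤ t * K := h1
      _ ≤ t * K * (7 * (1 / L')) := le_mul_of_one_le_right (by positivity) h3
      _ = 7 * K * t * (1 / L') := by ring
      _ ≤ C * t * (alphaf f t + β' + 1 / L') := by
        gcongr
        · have : 0 ≤ 4 * K * A ^ ((3:ℝ)/4) + (16 + 8 * K * B) := by positivity
          rw [hC]; linarith
        · linarith
  · have ht1 : 1 < t := by linarith
    have h0 := Real.log_pos ht1
    have h1 : |Vm f m t - t * (Dm m * ∑' n, Fm f m n)| ≤
        2 * Real.sqrt t * t ^ (1/4 : ℝ) +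
          t * ((alphaf f t + 4 * betaf f t + 4 * B / Real.log t) * K) := by
      refine abs_diff_le f hfin m ht0.le _ fun n => ?_
      calc _ ≤ ∑ b ∈ Finset.Icc 1 n, ((if (b:ℝ) ≤ t ^ (1/4 : ℝ) then 2 * Real.sqrt t else 0) +
              t * (aA f b * cc t b)) := Finset.sum_le_sum fun b hb =>
            Eb_le2 f hm0 ht1 hmt b (by rw [Finset.mem_Icc] at hb; omega)
        _ = (∑ b ∈ Finset.Icc 1 n, (if (b:ℝ) ≤ t ^ (1/4 : ℝ) then 2 * Real.sqrt t else 0)) +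
              t * ∑ b ∈ Finset.Icc 1 n, aA f b * cc t b := by
            rw [Finset.sum_add_distrib, Finset.mul_sum]
        _ ≤ _ := by
          refine add_le_add ?_ (mul_le_mul_of_nonneg_left ?_ ht0.le)
          · rw [← Finset.sum_filter, Finset.sum_const, nsmul_eq_mul, mul_comm]
            gcongr
            have hy : (0:ℝ) ≤ t ^ (1/4 : ℝ) := by positivity
            have hc : ((Finset.Icc 1 n).filter (fun b : ℕ => (b:ℝ) ≤ t ^ (1/4 : ℝ))).card ≤ ⌊t ^ (1/4 : ℝ)⌋₊ := by
              have hsub : (Finset.Icc 1 n).filter (fun b : ℕ => (b:ℝ) ≤ t ^ (1/4 : ℝ)) ⊆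
                  Finset.Icc 1 ⌊t ^ (1/4 : ℝ)⌋₊ := by
                intro b hb
                simp only [Finset.mem_filter, Finset.mem_Icc] at hb ⊢
                exact ⟨hb.1.1, Nat.le_floor hb.2⟩
              simpa using Finset.card_le_card hsub
            exact (Nat.cast_le.mpr hc).trans (Nat.floor_le hy)
          · refine (key_sum f (cc t) (cc_nonneg ht1) (by simp [cc]) (cc_sub ht1) n).trans ?_
            have h5 := tail_bound f hfin hB ht1 n
            refine mul_le_mul h5 (hK n) (Finset.sum_nonneg fun _ _ => aA_nonneg f _) ?_
            positivity
    have h2 : 2 * Real.sqrt t * t ^ (1/4 : ℝ) ≤ 8 * t * (1 / Real.log t) := by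
      rw [mul_one_div, le_div_iff₀ h0]
      have hl := Real.log_le_rpow_div ht0.le (show (0:ℝ) < 1/4 by norm_num)
      have hl' : Real.log t ≤ 4 * t ^ (1/4 : ℝ) := by linarith
      calc 2 * Real.sqrt t * t ^ (1/4 : ℝ) * Real.log t
          ≤ 2 * Real.sqrt t * t ^ (1/4 : ℝ) * (4 * t ^ (1/4 : ℝ)) := by gcongr
        _ = 8 * (t ^ (1/2 : ℝ) * t ^ (1/4 : ℝ) * t ^ (1/4 : ℝ)) := by
            rw [Real.sqrt_eq_rpow]; ring
        _ = 8 * t := by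
            rw [← Real.rpow_add ht0, ← Real.rpow_add ht0]; norm_num
    have h3 : 1 / Real.log t ≤ 2 * (1 / L') := by
      have a1 : Real.log (2 * t) ≤ 2 * Real.log t := by
        rw [Real.log_mul (by norm_num) ht0.ne']
        have := Real.log_le_log (by norm_num) (show (2:ℝ) ≤ t by linarith)
        linarith
      have a2 : 1 ≤ Real.log (2 * t) := by
        rw [Real.le_log_iff_exp_le (by linarith)]
        have := Real.exp_one_lt_d9
        linarith
      have a3 : L' ≤ Real.log (2 * t) := by
        calc L' ≤ Real.log (2 * t) ^ (1:ℝ) := Real.rpow_le_rpow_of_exponent_le a2 (by norm_num)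
          _ = _ := Real.rpow_one _
      rw [mul_one_div, div_le_div_iff₀ h0 hL']
      linarith
    have h5 : betaf f t ≤ A ^ ((3:ℝ)/4) * β' := by
      have hb := (beta_upper f hfin ht1).2
      calc betaf f t = betaf f t ^ ((3:ℝ)/4) * betaf f t ^ ((1:ℝ)/4) := by
            rw [← Real.rpow_add_of_nonneg hβ0 (by norm_num) (by norm_num)]; norm_num
        _ ≤ _ := by
            gcongr
    calc _ ≤ 8 * t * (1 / Real.log t) +
          t * ((alphaf f t + 4 * betaf f t + 4 * B * (1 / Real.log t)) * K) := by
          rw [mul_one_div (4 * B)]; linarith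
      _ ≤ 8 * t * (2 * (1 / L')) +
          t * ((alphaf f t + 4 * (A ^ ((3:ℝ)/4) * β') + 4 * B * (2 * (1 / L'))) * K) := by gcongr
      _ = t * (K * alphaf f t + 4 * K * A ^ ((3:ℝ)/4) * β' + (16 + 8 * K * B) * (1 / L')) := by ring
      _ ≤ t * (C * alphaf f t + C * β' + C * (1 / L')) := by
          have c0 : 0 ≤ 4 * K * A ^ ((3:ℝ)/4) := by positivity
          have c1 : 0 ≤ 16 + 8 * K * B := by positivity
          gcongr <;> (rw [hC]; linarith)
      _ = _ := by ring

end
end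

section
/- Let f be a real additive function such that the series Σ_p min(1, f(p)²)/p and Σ_{p : |f(p)|≤1} f(p)/p converge, and let 3 ≤ R ≤ x. Then, for every τ ∈ ℝ, ∏_{p > x} (1 − 1/p)·Σ_{ν≥0} e^{iτ f_R(p^ν)}/p^ν = exp{ O( η_f(x)·(1 + τ²) + 1/(x·log x) ) }, where the implied constant is absolute. -/
open Filter Topology Finset MeasureTheory
open scoped Classical

noncomputable section

lemma aux_dyadic (k : ℕ) : ∀ x : ℝ, 0 < x → ∀ S : Finset ℕ,
    (∀ p ∈ S, p.Prime ∧ x < (p:ℝ) ∧ (p:ℝ) ≤ 2 ^ k * x) →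
    ∑ p ∈ S, Real.log p / (p:ℝ) ^ 2 ≤ 4 * Real.log 4 / x := by
  have hl4 : 0 < Real.log 4 := Real.log_pos (by norm_num)
  induction k with
  | zero =>
    intro x hx S hS
    have : S = ∅ := by
      apply Finset.eq_empty_of_forall_notMem
      intro p hp
      obtain ⟨_, h1, h2⟩ := hS p hp
      simp at h2
      linarith
    subst this
    simp
    positivity
  | succ k ih =>
    intro x hx S hS
    rw [← Finset.sum_filter_add_sum_filter_not S (fun p : ℕ => (p:ℝ) ≤ 2 * x)]
    have h2 := ih (2 * x) (by positivity) (S.filter (fun p : ℕ => ¬ (p:ℝ) ≤ 2 * x)) (by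
      intro p hp
      rw [Finset.mem_filter] at hp
      obtain ⟨a, b, c⟩ := hS p hp.1
      refine ⟨a, by linarith [not_le.mp hp.2], ?_⟩
      rw [pow_succ] at c
      linarith)
    have h1 : ∑ p ∈ S.filter (fun p : ℕ => (p:ℝ) ≤ 2 * x), Real.log p / (p:ℝ) ^ 2
        ≤ Chebyshev.theta (2 * x) / x ^ 2 := by
      rw [Chebyshev.theta, Finset.sum_div]
      calc _ ≤ ∑ p ∈ S.filter (fun p : ℕ => (p:ℝ) ≤ 2 * x), Real.log p / x ^ 2 := by
            apply Finset.sum_le_sum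
            intro p hp
            rw [Finset.mem_filter] at hp
            obtain ⟨a, b, c⟩ := hS p hp.1
            have : 0 ≤ Real.log p := Real.log_natCast_nonneg p
            gcongr
        _ ≤ _ := by
            apply Finset.sum_le_sum_of_subset_of_nonneg
            · intro p hp
              rw [Finset.mem_filter] at hp
              obtain ⟨a, b, c⟩ := hS p hp.1
              simp only [Finset.mem_filter, Finset.mem_Ioc]
              exact ⟨⟨a.pos, Nat.le_floor hp.2⟩, a⟩
            · intro p _ _
              have : 0 ≤ Real.log p := Real.log_natCast_nonneg p
              positivity
    have h3 := Chebyshev.theta_le_log4_mul_x (x := 2 * x) (by positivity)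
    have h4 : Chebyshev.theta (2 * x) / x ^ 2 ≤ Real.log 4 * (2 * x) / x ^ 2 := by gcongr
    have h5 : Real.log 4 * (2 * x) / x ^ 2 + 4 * Real.log 4 / (2 * x) = 4 * Real.log 4 / x := by
      field_simp; ring
    linarith

lemma aux_prime_tail (x : ℝ) (hx : 3 ≤ x) (S : Finset ℕ)
    (hS : ∀ p ∈ S, p.Prime ∧ x < (p:ℝ)) :
    ∑ p ∈ S, 1 / (p:ℝ) ^ 2 ≤ 4 * Real.log 4 * (1 / (x * Real.log x)) := by
  have hlx : 0 < Real.log x := Real.log_pos (by linarith)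
  obtain ⟨k, hk⟩ : ∃ k : ℕ, ∀ p ∈ S, (p:ℝ) ≤ 2 ^ k * x := by
    refine ⟨S.sup id, fun p hp => ?_⟩
    have h1 : p ≤ S.sup id := Finset.le_sup (f := id) hp
    have h2 : p < 2 ^ (S.sup id) :=
      lt_of_le_of_lt h1 Nat.lt_two_pow_self
    have h3 : (p:ℝ) ≤ 2 ^ (S.sup id) := by exact_mod_cast h2.le
    have : (0:ℝ) < 2 ^ (S.sup id) := by positivity
    nlinarith
  have h := aux_dyadic k x (by linarith) S (fun p hp => ⟨(hS p hp).1, (hS p hp).2, hk p hp⟩)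
  have h2 : ∑ p ∈ S, 1 / (p:ℝ) ^ 2 ≤ (∑ p ∈ S, Real.log p / (p:ℝ) ^ 2) / Real.log x := by
    rw [Finset.sum_div]
    apply Finset.sum_le_sum
    intro p hp
    have hp' := (hS p hp).2
    have : Real.log x ≤ Real.log p := Real.log_le_log (by linarith) hp'.le
    have hp0 : (0:ℝ) < p := by linarith
    rw [div_div, div_le_div_iff₀ (by positivity) (by positivity)]
    have : (0:ℝ) < (p:ℝ)^2 := by positivity
    nlinarith
  calc _ ≤ _ := h2
    _ ≤ (4 * Real.log 4 / x) / Real.log x := by gcongr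
    _ = _ := by field_simp

lemma aux_exp_bound (t : ℝ) : ‖Complex.exp ((t:ℝ) * Complex.I) - 1 - t * Complex.I‖ ≤ 3 * t ^ 2 := by
  have hn : ‖(t:ℂ) * Complex.I‖ = |t| := by simp
  by_cases h : |t| ≤ 1
  · have := Complex.norm_exp_sub_one_sub_id_le (x := (t:ℂ) * Complex.I) (by rw [hn]; exact h)
    rw [hn, sq_abs] at this
    nlinarith [sq_nonneg t]
  · push Not at h
    have h1 := norm_sub_le (Complex.exp ((t:ℝ) * Complex.I) - 1) (t * Complex.I)
    have h2 := norm_sub_le (Complex.exp ((t:ℝ) * Complex.I)) 1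
    rw [Complex.norm_exp_ofReal_mul_I, norm_one] at h2
    rw [hn] at h1
    have := sq_abs t
    nlinarith

lemma aux_fR_pow (f : ℕ → ℝ) (R : ℝ) (p : ℕ) (hp : p.Prime) (hR : R < p) :
    fR f R p = if |f p| ≤ 1 then f p else 0 := by
  have : ¬ (p:ℝ) ≤ R := not_le.mpr hR
  simp [fR, hp.primeFactors, hp.factorization_self, this]

lemma aux_factor (a : ℕ → ℝ) (ha : a 0 = 0) (p : ℕ) (hp : 5 ≤ p) :
    ∃ r : ℂ, (1 - 1/(p:ℂ)) * ∑' ν : ℕ, Complex.exp ((a ν : ℝ) * Complex.I) / (p : ℂ) ^ ν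
      = Complex.exp ((a 1 / p : ℝ) * Complex.I + r) ∧
      ‖r‖ ≤ 3 * ((a 1)^2 / p) + 11 * (1 / (p:ℝ)^2) := by
  have hp5 : (5:ℝ) ≤ p := by exact_mod_cast hp
  have hp0 : (0:ℝ) < p := by linarith
  have hpc : (p:ℂ) ≠ 0 := by exact_mod_cast hp0.ne'
  set u : ℝ := 1 / p with hu
  have hu0 : 0 < u := by positivity
  have hu5 : u ≤ 1/5 := by rw [hu]; gcongr
  set e : ℕ → ℂ := fun ν => Complex.exp ((a ν : ℝ) * Complex.I) with he
  have hen : ∀ ν, ‖e ν‖ = 1 := fun ν => Complex.norm_exp_ofReal_mul_I _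
  have he0 : e 0 = 1 := by simp [he, ha]
  have hterm : ∀ ν, ‖e ν / (p:ℂ)^ν‖ = u ^ ν := by
    intro ν
    rw [norm_div, hen, norm_pow, Complex.norm_natCast, hu, one_div_pow]
  have hgeo : HasSum (fun ν : ℕ => u ^ (ν + 2)) (u^2 * (1 - u)⁻¹) := by
    have := (hasSum_geometric_of_lt_one hu0.le (by linarith : u < 1)).mul_left (u^2)
    simpa [pow_add, mul_comm] using this
  have hsum : Summable (fun ν => e ν / (p:ℂ)^ν) := by
    apply Summable.of_norm
    simp only [hterm]
    exact summable_geometric_of_lt_one hu0.le (by linarith)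
  set T : ℂ := ∑' ν : ℕ, e (ν+2) / (p:ℂ)^(ν+2) with hT
  have hTn : ‖T‖ ≤ u^2 * (1 - u)⁻¹ :=
    tsum_of_norm_bounded hgeo (fun ν => (hterm _).le)
  have hS : ∑' ν : ℕ, e ν / (p:ℂ)^ν = 1 + e 1 / p + T := by
    rw [← hsum.sum_add_tsum_nat_add 2]
    simp [Finset.sum_range_succ, he0, hT]
  set w : ℂ := (e 1 - 1) / p - e 1 / (p:ℂ)^2 + (1 - 1/(p:ℂ)) * T with hw
  have hfac : (1 - 1/(p:ℂ)) * ∑' ν : ℕ, e ν / (p:ℂ)^ν = 1 + w := by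
    rw [hS, hw]
    field_simp
    ring
  have hA : ‖e 1 / (p:ℂ)^2‖ = u^2 := by
    rw [norm_div, hen, norm_pow, Complex.norm_natCast, hu, one_div_pow]
  have h1u : ‖(1 - 1/(p:ℂ))‖ = 1 - u := by
    have : (1 - 1/(p:ℂ)) = ((1 - u : ℝ) : ℂ) := by simp [hu]
    rw [this, Complex.norm_real, Real.norm_of_nonneg (by linarith)]
  have hB : ‖(1 - 1/(p:ℂ)) * T‖ ≤ u^2 := by
    rw [norm_mul, h1u]
    calc (1 - u) * ‖T‖ ≤ (1 - u) * (u^2 * (1 - u)⁻¹) := by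
          gcongr; linarith
      _ = u^2 := by field_simp [show (1 - u) ≠ 0 by linarith]
  have hD : ‖(e 1 - 1) / (p:ℂ)‖ ≤ 2 * u := by
    rw [norm_div, Complex.norm_natCast, hu]
    have h2 := norm_sub_le (e 1) 1
    rw [hen, norm_one] at h2
    rw [div_eq_mul_one_div]
    gcongr
    linarith
  have hwD : ‖w - (e 1 - 1) / (p:ℂ)‖ ≤ 2 * u^2 := by
    have : w - (e 1 - 1) / (p:ℂ) = (1 - 1/(p:ℂ)) * T - e 1 / (p:ℂ)^2 := by rw [hw]; ring
    rw [this]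
    have := norm_sub_le ((1 - 1/(p:ℂ)) * T) (e 1 / (p:ℂ)^2)
    linarith
  have hwn : ‖w‖ ≤ 2 * u + 2 * u^2 := by
    have := norm_add_le ((e 1 - 1) / (p:ℂ)) (w - (e 1 - 1) / (p:ℂ))
    rw [add_sub_cancel] at this
    linarith
  have hw2 : ‖w‖ ≤ 1/2 := by nlinarith
  have hw3 : ‖w‖ ≤ 3 * u := by nlinarith
  have hlog := Complex.norm_log_one_add_sub_self_le (z := w) (by linarith)
  have hlog2 : ‖Complex.log (1 + w) - w‖ ≤ 9 * u^2 := by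
    have hi : (1 - ‖w‖)⁻¹ ≤ 2 := by
      rw [inv_le_comm₀ (by linarith) (by norm_num)]; linarith
    have : ‖w‖^2 * (1 - ‖w‖)⁻¹ / 2 ≤ ‖w‖^2 * 2 / 2 := by gcongr
    have h9 : ‖w‖^2 ≤ (3*u)^2 := by gcongr
    nlinarith
  have hE : ‖(e 1 - 1) / (p:ℂ) - (a 1 / p : ℝ) * Complex.I‖ ≤ 3 * ((a 1)^2 / p) := by
    have : (e 1 - 1) / (p:ℂ) - (a 1 / p : ℝ) * Complex.I
        = (e 1 - 1 - a 1 * Complex.I) / p := by push_cast; field_simp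
    rw [this, norm_div, Complex.norm_natCast, ← mul_div_assoc]
    gcongr
    exact aux_exp_bound (a 1)
  refine ⟨Complex.log (1 + w) - (a 1 / p : ℝ) * Complex.I, ?_, ?_⟩
  · rw [hfac, add_sub_cancel, Complex.exp_log]
    intro h0
    have : w = -1 := by linear_combination h0
    rw [this, norm_neg, norm_one] at hw2
    norm_num at hw2
  · have hsplit : Complex.log (1 + w) - (a 1 / p : ℝ) * Complex.I
        = (Complex.log (1 + w) - w) + (w - (e 1 - 1) / (p:ℂ))
          + ((e 1 - 1) / (p:ℂ) - (a 1 / p : ℝ) * Complex.I) := by ring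
    have hu2 : 1 / (p:ℝ)^2 = u^2 := by rw [hu, one_div_pow]
    rw [hsplit, hu2]
    have := norm_add₃_le (a := Complex.log (1 + w) - w) (b := w - (e 1 - 1) / (p:ℂ))
      (c := (e 1 - 1) / (p:ℂ) - (a 1 / p : ℝ) * Complex.I)
    linarith

lemma aux_summable (f : ℕ → ℝ) (hf : EWConv f) (y : ℝ) :
    Summable (fun n : ℕ => if IsPrimePow n ∧ y < (n : ℝ) then min 1 (f n ^ 2) / (n : ℝ) else 0) := by
  have h1 : Summable (fun n : ℕ => if n.Prime then min 1 (f n ^ 2) / (n : ℝ) else 0) := by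
    have := hf.1
    have h := (summable_subtype_iff_indicator (s := {p : ℕ | p.Prime})
      (f := fun n : ℕ => min 1 (f n ^ 2) / (n : ℝ))).mp this
    refine h.congr fun n => ?_
    simp [Set.indicator_apply]
  have h2 := (ArithmeticFunction.vonMangoldt.summable_residueClass_non_primes_div
    (q := 1) (a := 0)).mul_left (Real.log 2)⁻¹
  have hl2 : 0 < Real.log 2 := Real.log_pos (by norm_num)
  refine Summable.of_nonneg_of_le (fun n => ?_) (fun n => ?_) (h1.add h2)
  · split_ifs
    · have : 0 ≤ min 1 (f n ^ 2) := by positivity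
      positivity
    · exact le_rfl
  · have h0 : 0 ≤ min 1 (f n ^ 2) := by positivity
    by_cases hn : n.Prime
    · simp only [hn, if_true]
      split_ifs
      · simp
      · simp; positivity
    · have hres : ArithmeticFunction.vonMangoldt.residueClass (0 : ZMod 1) n
          = ArithmeticFunction.vonMangoldt n := by
        rw [ArithmeticFunction.vonMangoldt.residueClass, Set.indicator_of_mem]
        exact Subsingleton.elim _ _
      simp only [hn, if_false, hres, zero_add]
      split_ifs with hc
      · have hpp := hc.1
        rw [ArithmeticFunction.vonMangoldt_apply, if_pos hpp, ← mul_div_assoc]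
        gcongr
        have hmf : (2:ℝ) ≤ n.minFac := by
          exact_mod_cast (Nat.minFac_prime hpp.ne_one).two_le
        have : Real.log 2 ≤ Real.log n.minFac := Real.log_le_log (by norm_num) hmf
        calc min 1 (f n ^ 2) ≤ 1 := min_le_left _ _
          _ = (Real.log 2)⁻¹ * Real.log 2 := by field_simp
          _ ≤ _ := by gcongr
      · have := ArithmeticFunction.vonMangoldt_nonneg (n := n)
        positivity

/-- The tail product estimate of Section 4: for `3 ≤ R ≤ x` and all `τ`,
`∏_{p > x} (1 − 1/p) Σ_{ν≥0} e^{iτ f_R(p^ν)}/p^ν = exp{O(η_f(x)(1 + τ²) + 1/(x log x))}`,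
with an absolute implied constant. -/
theorem tail_euler_product :
    ∃ C : ℝ, 0 < C ∧
      ∀ (f : ℕ → ℝ) (η : ℝ → ℝ), IsAdditive f → EWConv f → EtaBound f η →
        ∀ R x τ : ℝ, 3 ≤ R → R ≤ x →
          ∃ z : ℂ,
            Tendsto (fun N : ℕ =>
                ∏ p ∈ (Finset.range N).filter (fun p => Nat.Prime p ∧ x < (p : ℝ)),
                  ((1 - 1/(p:ℂ)) * ∑' ν : ℕ,
                    Complex.exp ((τ * fR f R (p ^ ν) : ℝ) * Complex.I) / (p : ℂ) ^ ν))
              atTop (𝓝 (Complex.exp z)) ∧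
            ‖z‖ ≤ C * (η x * (1 + τ^2) + 1 / (x * Real.log x)) := by
  refine ⟨50 + 44 * Real.log 4, by have := Real.log_pos (x := 4) (by norm_num); positivity, ?_⟩
  intro f η hadd hew heta R x τ hR hRx
  have hx3 : 3 ≤ x := hR.trans hRx
  obtain ⟨-, -, -, he1, he2⟩ := heta
  obtain ⟨l, hl, hlη⟩ := he1 x (by linarith)
  have hs := he2 x (by linarith)
  have hη0 : 0 ≤ η x := (abs_nonneg l).trans hlη
  have hsum := aux_summable f hew x
  have hl4 : 0 < Real.log 4 := Real.log_pos (by norm_num)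
  have hlx : 0 < Real.log x := Real.log_pos (by linarith)
  -- the local factors
  have hfac : ∀ p : ℕ, ∃ r : ℂ, (p.Prime ∧ x < (p:ℝ)) →
      ((1 - 1/(p:ℂ)) * ∑' ν : ℕ,
        Complex.exp ((τ * fR f R (p ^ ν) : ℝ) * Complex.I) / (p : ℂ) ^ ν
        = Complex.exp ((τ * fR f R p / p : ℝ) * Complex.I + r) ∧
      ‖r‖ ≤ 3 * ((τ * fR f R p)^2 / p) + 11 * (1 / (p:ℝ)^2)) := by
    intro p
    by_cases hp : p.Prime ∧ x < (p:ℝ)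
    · have hp3 : 3 < p := by exact_mod_cast lt_of_le_of_lt hx3 hp.2
      have hp4 : p ≠ 4 := by
        rintro rfl
        exact absurd hp.1 (by norm_num)
      obtain ⟨r, h1, h2⟩ := aux_factor (fun ν => τ * fR f R (p ^ ν)) (by simp [fR]) p (by omega)
      simp only [pow_one] at h1 h2
      exact ⟨r, fun _ => ⟨h1, h2⟩⟩
    · exact ⟨0, fun h => absurd h hp⟩
  choose r hr using hfac
  set P : ℕ → Prop := fun p => p.Prime ∧ x < (p:ℝ) with hP
  set F : ℕ → ℝ := fun n => if IsPrimePow n ∧ x < (n : ℝ) then min 1 (f n ^ 2) / (n : ℝ) else 0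
    with hF
  set Q : ℕ → ℝ := fun n => if P n then 1 / (n:ℝ)^2 else 0 with hQ
  have hQ0 : ∀ n, 0 ≤ Q n := by
    intro n; simp only [hQ]; split_ifs <;> positivity
  have hQb : ∀ N : Finset ℕ, ∑ n ∈ N, Q n ≤ 4 * Real.log 4 * (1 / (x * Real.log x)) := by
    intro N
    simp only [hQ]
    rw [← Finset.sum_filter]
    apply aux_prime_tail x hx3
    intro p hp
    exact (Finset.mem_filter.mp hp).2
  have hQs : Summable Q := summable_of_sum_le hQ0 hQb
  have hQt : ∑' n, Q n ≤ 4 * Real.log 4 * (1 / (x * Real.log x)) :=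
    hQs.tsum_le_of_sum_le hQb
  set ρ : ℕ → ℂ := fun n => if P n then r n else 0 with hρ
  have hρb : ∀ n, ‖ρ n‖ ≤ 3 * τ^2 * F n + 11 * Q n := by
    intro n
    by_cases hn : P n
    · have h := (hr n hn).2
      rw [aux_fR_pow f R n hn.1 (lt_of_le_of_lt hRx hn.2)] at h
      have hpp : IsPrimePow n ∧ x < (n:ℝ) := ⟨hn.1.prime.isPrimePow, hn.2⟩
      simp only [hρ, hF, hQ, if_pos hn, if_pos hpp]
      refine h.trans ?_
      rw [mul_pow, mul_div_assoc, ← mul_assoc]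
      have : (if |f n| ≤ 1 then f n else 0)^2 ≤ min 1 (f n ^ 2) := by
        split_ifs with h1
        · exact le_min ((sq_le_one_iff_abs_le_one _).mpr h1) le_rfl
        · simp; positivity
      gcongr
    · have : 0 ≤ F n := by
        simp only [hF]
        split_ifs
        · have : 0 ≤ min 1 (f n ^ 2) := by positivity
          positivity
        · exact le_rfl
      simp only [hρ, if_neg hn, norm_zero]
      have := hQ0 n
      positivity
  have hbs : Summable (fun n => 3 * τ^2 * F n + 11 * Q n) :=
    (hsum.mul_left _).add (hQs.mul_left _)
  have hρs : Summable ρ := Summable.of_norm_bounded hbs hρb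
  have hρt : ‖∑' n, ρ n‖ ≤ 3 * τ^2 * η x + 11 * (4 * Real.log 4 * (1 / (x * Real.log x))) := by
    have h1 := tsum_of_norm_bounded hbs.hasSum hρb
    rw [(hsum.mul_left _).tsum_add (hQs.mul_left _), tsum_mul_left, tsum_mul_left] at h1
    refine h1.trans ?_
    gcongr
  refine ⟨(τ * l : ℝ) * Complex.I + ∑' n, ρ n, ?_, ?_⟩
  · have hconv : Tendsto (fun N : ℕ => Complex.exp
        ((τ * (∑ p ∈ (Finset.range N).filter (fun p => Nat.Prime p ∧ x < (p : ℝ) ∧ |f p| ≤ 1),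
          f p / (p : ℝ)) : ℝ) * Complex.I + ∑ n ∈ Finset.range N, ρ n)) atTop
        (𝓝 (Complex.exp ((τ * l : ℝ) * Complex.I + ∑' n, ρ n))) := by
      apply (Complex.continuous_exp.tendsto _).comp
      apply Tendsto.add _ hρs.hasSum.tendsto_sum_nat
      apply Tendsto.mul_const
      exact (Complex.continuous_ofReal.tendsto _).comp (hl.const_mul τ)
    refine hconv.congr fun N => ?_
    have hrw : ∀ p ∈ (Finset.range N).filter (fun p => Nat.Prime p ∧ x < (p : ℝ)),
        ((1 - 1/(p:ℂ)) * ∑' ν : ℕ,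
          Complex.exp ((τ * fR f R (p ^ ν) : ℝ) * Complex.I) / (p : ℂ) ^ ν)
        = Complex.exp ((τ * ((if |f p| ≤ 1 then f p else 0) / p) : ℝ) * Complex.I + r p) := by
      intro p hp
      have hpP := (Finset.mem_filter.mp hp).2
      rw [(hr p hpP).1, aux_fR_pow f R p hpP.1 (lt_of_le_of_lt hRx hpP.2), mul_div_assoc]
    rw [Finset.prod_congr rfl hrw, ← Complex.exp_sum, Finset.sum_add_distrib, ← Finset.sum_mul,
      ← Complex.ofReal_sum, ← Finset.mul_sum]
    have e1 : ∑ p ∈ (Finset.range N).filter (fun p => Nat.Prime p ∧ x < (p : ℝ) ∧ |f p| ≤ 1),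
          f p / (p : ℝ) = ∑ p ∈ (Finset.range N).filter (fun p => Nat.Prime p ∧ x < (p : ℝ)),
          (if |f p| ≤ 1 then f p else 0) / (p : ℝ) := by
      rw [Finset.sum_filter, Finset.sum_filter]
      refine Finset.sum_congr rfl fun p _ => ?_
      by_cases h1 : p.Prime <;> by_cases h2 : x < (p:ℝ) <;> by_cases h3 : |f p| ≤ 1 <;>
        simp [h1, h2, h3]
    have e2 : ∑ n ∈ Finset.range N, ρ n
        = ∑ p ∈ (Finset.range N).filter (fun p => Nat.Prime p ∧ x < (p : ℝ)), r p := by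
      rw [Finset.sum_filter]
    rw [e1, e2]
  · have h1 := norm_add_le ((τ * l : ℝ) * Complex.I) (∑' n, ρ n)
    have h2 : ‖((τ * l : ℝ) : ℂ) * Complex.I‖ ≤ |τ| * η x := by
      rw [norm_mul, Complex.norm_I, mul_one, Complex.norm_real, Real.norm_eq_abs, abs_mul]
      gcongr
    have h3 : |τ| ≤ 1 + τ^2 := by
      nlinarith [sq_abs τ, sq_nonneg (|τ| - 1), abs_nonneg τ]
    have h4 : |τ| * η x ≤ (1 + τ^2) * η x := by gcongr
    set E : ℝ := 1 / (x * Real.log x) with hE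
    have hE0 : 0 ≤ E := by positivity
    have h5 : 0 ≤ η x * τ^2 := by positivity
    have h6 : 0 ≤ Real.log 4 * (η x * (1 + τ^2)) := by positivity
    nlinarith

end
end
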